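/- Let φ : A → B be a DG smooth homomorphism of strongly commutative DG R-algebras. If N is a bounded below semifree DG B-module with Ext^i_B(N,N) = 0 for all i ≥ 1, then N is naively liftable to A; moreover, N is a direct summand of a DG B-module that is liftable to A. -/

import Mathlib

/-!
Common framework: strongly commutative non-negatively graded DG algebras over a
commutative ring `R`, right DG modules, semifree DG modules, Ext via the Hom complex,
homotopies, enveloping DG algebras, diagonal ideals, DG (quasi-)smoothness,
polynomial and free (divided power) extensions, and naive lifting.
-/

noncomputable section

/-- The Koszul sign `(-1)^i` for an integer `i`. -/
def ksign (i : ℤ) : ℤ := (((-1 : ℤˣ) ^ i : ℤˣ) : ℤ)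

/-- A strongly commutative, non-negatively graded differential graded algebra over a
commutative ring `R`: a graded `R`-algebra `A = ⊕_{n ≥ 0} A_n` with
`a * b = (-1)^{|a||b|} b * a`, `a^2 = 0` for `|a|` odd, and an `R`-linear degree `-1`
differential `d` with `d ∘ d = 0` satisfying the Leibniz rule. -/
structure DGAlgebra (R : Type) [CommRing R] where
  carrier : Type
  [ring : Ring carrier]
  [alg : Algebra R carrier]
  grading : ℤ → Submodule R carrier
  indep : ∀ i : ℤ, Disjoint (grading i) (⨆ j ≠ i, grading j)
  spanning : (⨆ i, grading i) = ⊤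
  nonneg : ∀ i : ℤ, i < 0 → grading i = ⊥
  one_mem : (1 : carrier) ∈ grading 0
  mul_mem : ∀ {i j : ℤ} {a b : carrier}, a ∈ grading i → b ∈ grading j →
    a * b ∈ grading (i + j)
  gcomm : ∀ {i j : ℤ} (a b : carrier), a ∈ grading i → b ∈ grading j →
    a * b = ksign (i * j) • (b * a)
  odd_sq : ∀ {i : ℤ} (a : carrier), Odd i → a ∈ grading i → a * a = 0
  d : carrier → carrier
  d_add : ∀ a b, d (a + b) = d a + d b
  d_rsmul : ∀ (r : R) a, d (r • a) = r • d a
  d_mem : ∀ {i : ℤ} {a : carrier}, a ∈ grading i → d a ∈ grading (i - 1)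
  d_sq : ∀ a, d (d a) = 0
  leibniz : ∀ {i : ℤ} (a b : carrier), a ∈ grading i →
    d (a * b) = d a * b + ksign i • (a * d b)

attribute [instance] DGAlgebra.ring DGAlgebra.alg

variable {R : Type} [CommRing R]

/-- A right DG module over a DG `R`-algebra `A`. -/
structure DGModule (R : Type) [CommRing R] (A : DGAlgebra R) where
  carrier : Type
  [acg : AddCommGroup carrier]
  [modR : Module R carrier]
  grading : ℤ → Submodule R carrier
  indep : ∀ i : ℤ, Disjoint (grading i) (⨆ j ≠ i, grading j)
  spanning : (⨆ i, grading i) = ⊤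
  smul : carrier → A.carrier → carrier
  smul_add : ∀ (m : carrier) (a b : A.carrier), smul m (a + b) = smul m a + smul m b
  add_smul : ∀ (m n : carrier) (a : A.carrier), smul (m + n) a = smul m a + smul n a
  smul_rsmul : ∀ (r : R) (m : carrier) (a : A.carrier), smul m (r • a) = r • smul m a
  rsmul_smul : ∀ (r : R) (m : carrier) (a : A.carrier), smul (r • m) a = r • smul m a
  smul_one : ∀ m : carrier, smul m 1 = m
  smul_mul : ∀ (m : carrier) (a b : A.carrier), smul (smul m a) b = smul m (a * b)
  smul_mem : ∀ {i j : ℤ} {m : carrier} {a : A.carrier},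
    m ∈ grading i → a ∈ A.grading j → smul m a ∈ grading (i + j)
  d : carrier → carrier
  d_add : ∀ x y, d (x + y) = d x + d y
  d_rsmul : ∀ (r : R) x, d (r • x) = r • d x
  d_mem : ∀ {i : ℤ} {m : carrier}, m ∈ grading i → d m ∈ grading (i - 1)
  d_sq : ∀ m, d (d m) = 0
  leibniz : ∀ {i : ℤ} (m : carrier) (a : A.carrier), m ∈ grading i →
    d (smul m a) = smul (d m) a + ksign i • smul m (A.d a)

attribute [instance] DGModule.acg DGModule.modR

/-- A graded `A`-linear map of degree `k` between DG `A`-modules (not necessarily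
compatible with the differentials). -/
structure GradedHom {A : DGAlgebra R} (M N : DGModule R A) (k : ℤ) where
  toFun : M.carrier → N.carrier
  map_add : ∀ x y, toFun (x + y) = toFun x + toFun y
  map_rsmul : ∀ (r : R) x, toFun (r • x) = r • toFun x
  map_smul : ∀ (x : M.carrier) (a : A.carrier), toFun (M.smul x a) = N.smul (toFun x) a
  map_mem : ∀ {i : ℤ} {x : M.carrier}, x ∈ M.grading i → toFun x ∈ N.grading (i + k)

/-- A homomorphism of DG `A`-modules: a degree `0` graded `A`-linear chain map. -/
structure DGHom {A : DGAlgebra R} (M N : DGModule R A) where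
  toFun : M.carrier → N.carrier
  map_add : ∀ x y, toFun (x + y) = toFun x + toFun y
  map_rsmul : ∀ (r : R) x, toFun (r • x) = r • toFun x
  map_smul : ∀ (x : M.carrier) (a : A.carrier), toFun (M.smul x a) = N.smul (toFun x) a
  map_mem : ∀ {i : ℤ} {x : M.carrier}, x ∈ M.grading i → toFun x ∈ N.grading i
  comm_d : ∀ x, toFun (M.d x) = N.d (toFun x)

/-- A degree `-k` element `f` of the Hom complex `Hom_A(N, M)` is a cocycle
(representing a class in `Ext^k_A(N,M) = H_{-k}(Hom_A(N,M))`). -/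
def IsExtCocycle {A : DGAlgebra R} {N M : DGModule R A} (k : ℤ)
    (f : GradedHom N M (-k)) : Prop :=
  ∀ x, M.d (f.toFun x) = ksign k • f.toFun (N.d x)

/-- A degree `-k` cocycle of the Hom complex is a coboundary. -/
def IsExtCoboundary {A : DGAlgebra R} {N M : DGModule R A} (k : ℤ)
    (f : GradedHom N M (-k)) : Prop :=
  ∃ h : GradedHom N M (-k + 1), ∀ x,
    f.toFun x = M.d (h.toFun x) + ksign k • h.toFun (N.d x)

/-- `Ext^k_A(N, M) = H_{-k}(Hom_A(N, M)) = 0`. -/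
def ExtVanish {A : DGAlgebra R} (k : ℤ) (N M : DGModule R A) : Prop :=
  ∀ f : GradedHom N M (-k), IsExtCocycle k f → IsExtCoboundary k f

/-- A DG module homomorphism `j : M' → M` induces an isomorphism
`Ext^k_A(N, M') ≅ Ext^k_A(N, M)`; stated at the level of cocycles and coboundaries
of the Hom complexes (injectivity and surjectivity of the induced map on `H_{-k}`). -/
def InducesExtIso {A : DGAlgebra R} (k : ℤ) (N : DGModule R A) {M' M : DGModule R A}
    (j : DGHom M' M) : Prop :=
  (∀ f : GradedHom N M' (-k), IsExtCocycle k f →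
    (∃ h : GradedHom N M (-k + 1), ∀ x,
      j.toFun (f.toFun x) = M.d (h.toFun x) + ksign k • h.toFun (N.d x)) →
    IsExtCoboundary k f) ∧
  (∀ g : GradedHom N M (-k), IsExtCocycle k g →
    ∃ f : GradedHom N M' (-k), IsExtCocycle k f ∧
      ∃ h : GradedHom N M (-k + 1), ∀ x,
        j.toFun (f.toFun x) - g.toFun x = M.d (h.toFun x) + ksign k • h.toFun (N.d x))

/-- Two maps of DG `A`-modules are homotopic: `f - g = ∂ ∘ h + h ∘ ∂` for a graded
`A`-linear map `h` of degree `1`. -/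
def DGHomotopic {A : DGAlgebra R} {M N : DGModule R A}
    (f g : M.carrier → N.carrier) : Prop :=
  ∃ h : GradedHom M N 1, ∀ x, f x - g x = N.d (h.toFun x) + h.toFun (M.d x)

/-- A DG module homomorphism `j : M' → M` induces a bijection
`Hom_{K(A)}(N, M') ≅ Hom_{K(A)}(N, M)` on homotopy classes of DG homomorphisms. -/
def InducesHtpyBij {A : DGAlgebra R} (N : DGModule R A) {M' M : DGModule R A}
    (j : DGHom M' M) : Prop :=
  (∀ f g : DGHom N M',
    DGHomotopic (fun x => j.toFun (f.toFun x)) (fun x => j.toFun (g.toFun x)) →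
    DGHomotopic f.toFun g.toFun) ∧
  (∀ g : DGHom N M, ∃ f : DGHom N M',
    DGHomotopic (fun x => j.toFun (f.toFun x)) g.toFun)

/-- A semifree basis of a DG `A`-module `N` on a family `e : κ → N`: a well-ordering
of `κ`, degrees making each `e k` homogeneous, such that `e` is a basis of the
underlying graded `A`-module and `∂(e k) ∈ Σ_{j < k} (e j)·A`. -/
structure SemifreeBasisOn {A : DGAlgebra R} (N : DGModule R A) {κ : Type}
    (e : κ → N.carrier) where
  lt : κ → κ → Prop
  wf : WellFounded lt
  trans : ∀ a b c, lt a b → lt b c → lt a c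
  trichotomous : ∀ a b, lt a b ∨ a = b ∨ lt b a
  deg : κ → ℤ
  homog : ∀ k, e k ∈ N.grading (deg k)
  basis : Function.Bijective
    (fun c : κ →₀ A.carrier => c.sum fun k a => N.smul (e k) a)
  d_lower : ∀ k, ∃ c : κ →₀ A.carrier, (∀ j ∈ c.support, lt j k) ∧
    N.d (e k) = c.sum fun j a => N.smul (e j) a

/-- A DG `A`-module is semifree if it admits a semifree basis. -/
def IsSemifree {A : DGAlgebra R} (N : DGModule R A) : Prop :=
  ∃ (κ : Type) (e : κ → N.carrier), Nonempty (SemifreeBasisOn N e)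

/-- A DG `A`-module has a finite semifree basis. -/
def HasFiniteSemifreeBasis {A : DGAlgebra R} (N : DGModule R A) : Prop :=
  ∃ (κ : Type) (e : κ → N.carrier), Finite κ ∧ Nonempty (SemifreeBasisOn N e)

/-- A DG module is bounded below: `N_i = 0` for `i ≪ 0`. -/
def BoundedBelow {A : DGAlgebra R} (N : DGModule R A) : Prop :=
  ∃ n₀ : ℤ, ∀ i : ℤ, i < n₀ → N.grading i = ⊥

/-- A homomorphism of DG `R`-algebras. -/
structure DGAlgHom (A B : DGAlgebra R) where
  toFun : A.carrier → B.carrier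
  map_one : toFun 1 = 1
  map_mul : ∀ x y, toFun (x * y) = toFun x * toFun y
  map_add : ∀ x y, toFun (x + y) = toFun x + toFun y
  map_rsmul : ∀ (r : R) x, toFun (r • x) = r • toFun x
  map_mem : ∀ {i : ℤ} {x : A.carrier}, x ∈ A.grading i → toFun x ∈ B.grading i
  comm_d : ∀ x, toFun (A.d x) = B.d (toFun x)

/-- A DG `A`-module homomorphism from a DG `A`-module `M` to (the restriction of
scalars along `φ : A → B` of) a DG `B`-module `W`. -/
structure ResHom {A B : DGAlgebra R} (φ : DGAlgHom A B) (M : DGModule R A)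
    (W : DGModule R B) where
  toFun : M.carrier → W.carrier
  map_add : ∀ x y, toFun (x + y) = toFun x + toFun y
  map_rsmul : ∀ (r : R) x, toFun (r • x) = r • toFun x
  map_mem : ∀ {i : ℤ} {x : M.carrier}, x ∈ M.grading i → toFun x ∈ W.grading i
  map_smul : ∀ (x : M.carrier) (a : A.carrier),
    toFun (M.smul x a) = W.smul (toFun x) (φ.toFun a)
  comm_d : ∀ x, toFun (M.d x) = W.d (toFun x)

/-- `T` is (up to isomorphism) the base change `M ⊗_A B` of the DG `A`-module `M`
along `φ : A → B`: universal property of the unit map `M → T`, `m ↦ m ⊗ 1`. -/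
structure DGBaseChange {A B : DGAlgebra R} (φ : DGAlgHom A B) (M : DGModule R A)
    (T : DGModule R B) where
  unit : ResHom φ M T
  univ : ∀ (W : DGModule R B) (f : ResHom φ M W),
    ∃ g : DGHom T W, (∀ x, g.toFun (unit.toFun x) = f.toFun x) ∧
      ∀ g' : DGHom T W, (∀ x, g'.toFun (unit.toFun x) = f.toFun x) →
        ∀ t, g'.toFun t = g.toFun t

/-- A DG `B`-module `W` is liftable to `A` along `φ : A → B` if `W ≅ M ⊗_A B`
for some DG `A`-module `M`. -/
def LiftableTo {A B : DGAlgebra R} (φ : DGAlgHom A B) (W : DGModule R B) : Prop :=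
  ∃ M : DGModule R A, Nonempty (DGBaseChange φ M W)

/-- An `A`-linear (via `φ : A → B`) chain map between the restrictions of two
DG `B`-modules. -/
structure ResHomB {A B : DGAlgebra R} (φ : DGAlgHom A B) (N W : DGModule R B) where
  toFun : N.carrier → W.carrier
  map_add : ∀ x y, toFun (x + y) = toFun x + toFun y
  map_rsmul : ∀ (r : R) x, toFun (r • x) = r • toFun x
  map_mem : ∀ {i : ℤ} {x : N.carrier}, x ∈ N.grading i → toFun x ∈ W.grading i
  map_smul : ∀ (x : N.carrier) (a : A.carrier),
    toFun (N.smul x (φ.toFun a)) = W.smul (toFun x) (φ.toFun a)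
  comm_d : ∀ x, toFun (N.d x) = W.d (toFun x)

/-- `T` is (up to isomorphism) the induced DG `B`-module `N|_A ⊗_A B` of a
DG `B`-module `N` along `φ : A → B`, with unit map `n ↦ n ⊗ 1`. -/
structure InducedModuleSpec {A B : DGAlgebra R} (φ : DGAlgHom A B)
    (N T : DGModule R B) where
  unit : ResHomB φ N T
  univ : ∀ (W : DGModule R B) (f : ResHomB φ N W),
    ∃ g : DGHom T W, (∀ x, g.toFun (unit.toFun x) = f.toFun x) ∧
      ∀ g' : DGHom T W, (∀ x, g'.toFun (unit.toFun x) = f.toFun x) →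
        ∀ t, g'.toFun t = g.toFun t

/-- `N` is naively liftable to `A` along `φ : A → B`: the canonical DG `B`-module
epimorphism `π_N : N|_A ⊗_A B → N`, `n ⊗ b ↦ nb` (characterized as the unique
DG `B`-map splitting the unit) admits a right inverse DG `B`-module homomorphism. -/
def NaivelyLiftable {A B : DGAlgebra R} (φ : DGAlgHom A B) (N : DGModule R B) : Prop :=
  ∀ (T : DGModule R B) (h : InducedModuleSpec φ N T) (πN : DGHom T N),
    (∀ x, πN.toFun (h.unit.toFun x) = x) →
    ∃ ρ : DGHom N T, ∀ y, πN.toFun (ρ.toFun y) = y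

/-- `N` is a direct summand of `W` as DG modules. -/
def IsDGDirectSummandOf {A : DGAlgebra R} (N W : DGModule R A) : Prop :=
  ∃ (ρ : DGHom N W) (p : DGHom W N), ∀ x, p.toFun (ρ.toFun x) = x

/-- `N` is a direct summand of some DG `B`-module which is liftable to `A`. -/
def DirectSummandOfLiftable {A B : DGAlgebra R} (φ : DGAlgHom A B)
    (N : DGModule R B) : Prop :=
  ∃ W : DGModule R B, LiftableTo φ W ∧ IsDGDirectSummandOf N W

/-- `B` is free as an underlying graded `A`-module (via `φ : A → B`), with a basis
of homogeneous elements. -/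
def FreeOverBase {A B : DGAlgebra R} (φ : DGAlgHom A B) : Prop :=
  ∃ (κ : Type) (e : κ → B.carrier) (dg : κ → ℤ),
    (∀ k, e k ∈ B.grading (dg k)) ∧
    Function.Bijective (fun c : κ →₀ A.carrier => c.sum fun k a => e k * φ.toFun a)

/-- `E` is (up to isomorphism) the enveloping DG algebra `B^e = B^o ⊗_A B` of
`φ : A → B`: it receives the two canonical maps `l : B° → E`, `b ↦ b^o ⊗ 1` and
`r : B → E`, `b ↦ 1^o ⊗ b` agreeing on `A`, and is universal (as a pushout of
strongly commutative DG algebras) with this property. -/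
structure EnvelopingAlg {A B : DGAlgebra R} (φ : DGAlgHom A B) (E : DGAlgebra R) where
  l : DGAlgHom B E
  r : DGAlgHom B E
  compat : ∀ a, l.toFun (φ.toFun a) = r.toFun (φ.toFun a)
  univ : ∀ (C : DGAlgebra R) (f g : DGAlgHom B C),
    (∀ a, f.toFun (φ.toFun a) = g.toFun (φ.toFun a)) →
    ∃ h : DGAlgHom E C, (∀ b, h.toFun (l.toFun b) = f.toFun b) ∧
      (∀ b, h.toFun (r.toFun b) = g.toFun b) ∧
      ∀ h' : DGAlgHom E C,
        ((∀ b, h'.toFun (l.toFun b) = f.toFun b) ∧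
          (∀ b, h'.toFun (r.toFun b) = g.toFun b)) → ∀ x, h'.toFun x = h.toFun x

/-- The diagonal ideal `J = ker(π_B : B^e → B)`. -/
def diagIdeal {A B E : DGAlgebra R} {φ : DGAlgHom A B} (_ : EnvelopingAlg φ E)
    (πB : DGAlgHom E B) : Set E.carrier :=
  {x | πB.toFun x = 0}

/-- A balanced pairing `N × S → W` realizing (maps out of) `N ⊗_B (S/Z)`, where
`S ⊆ B^e` is a DG `(B,B)`-sub-bimodule of `B^e` (left `B`-action via `l`, right
`B`-action via `r`) and `Z ⊆ S` is killed. -/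
structure TensorPairing {A B E : DGAlgebra R} (φ : DGAlgHom A B)
    (he : EnvelopingAlg φ E) (S Z : Set E.carrier) (N W : DGModule R B) where
  pair : N.carrier → E.carrier → W.carrier
  add_left : ∀ n n' x, x ∈ S → pair (n + n') x = pair n x + pair n' x
  add_right : ∀ n x y, x ∈ S → y ∈ S → pair n (x + y) = pair n x + pair n y
  rsmul_left : ∀ (r : R) n x, x ∈ S → pair (r • n) x = r • pair n x
  rsmul_right : ∀ (r : R) n x, x ∈ S → pair n (r • x) = r • pair n x
  balanced : ∀ (n : N.carrier) (b : B.carrier) (x : E.carrier), x ∈ S →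
    pair (N.smul n b) x = pair n (he.l.toFun b * x)
  act_right : ∀ (n : N.carrier) (b : B.carrier) (x : E.carrier), x ∈ S →
    pair n (x * he.r.toFun b) = W.smul (pair n x) b
  grade : ∀ {i j : ℤ} (n : N.carrier) (x : E.carrier),
    n ∈ N.grading i → x ∈ S → x ∈ E.grading j → pair n x ∈ W.grading (i + j)
  chain : ∀ {i : ℤ} (n : N.carrier) (x : E.carrier), n ∈ N.grading i → x ∈ S →
    W.d (pair n x) = pair (N.d n) x + ksign i • pair n (E.d x)
  kill : ∀ n x, x ∈ Z → pair n x = 0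

/-- `P` is (up to isomorphism) the right DG `B`-module `N ⊗_B (S/Z)`:
universal property among balanced pairings. -/
structure IsTensorSubquot {A B E : DGAlgebra R} (φ : DGAlgHom A B)
    (he : EnvelopingAlg φ E) (S Z : Set E.carrier) (N P : DGModule R B) where
  pairing : TensorPairing φ he S Z N P
  univ : ∀ (W : DGModule R B) (γ : TensorPairing φ he S Z N W),
    ∃ g : DGHom P W, (∀ n x, x ∈ S → g.toFun (pairing.pair n x) = γ.pair n x) ∧
      ∀ g' : DGHom P W, (∀ n x, x ∈ S → g'.toFun (pairing.pair n x) = γ.pair n x) →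
        ∀ p, g'.toFun p = g.toFun p

/-- `Q` is (up to isomorphism) the quotient `S/Z` of DG `B^e`-submodules
`Z ⊆ S ⊆ B^e`, regarded as a right DG `B`-module via `r : B → B^e`. -/
structure SubquotModSpec {A B E : DGAlgebra R} {φ : DGAlgHom A B}
    (he : EnvelopingAlg φ E) (S Z : Set E.carrier) (Q : DGModule R B) where
  q : E.carrier → Q.carrier
  q_add : ∀ x y, x ∈ S → y ∈ S → q (x + y) = q x + q y
  q_rsmul : ∀ (r : R) x, x ∈ S → q (r • x) = r • q x
  q_mem : ∀ {i : ℤ} (x : E.carrier), x ∈ S → x ∈ E.grading i → q x ∈ Q.grading i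
  q_d : ∀ x, x ∈ S → q (E.d x) = Q.d (q x)
  q_act : ∀ (x : E.carrier) (b : B.carrier), x ∈ S →
    q (x * he.r.toFun b) = Q.smul (q x) b
  q_surj : ∀ y, ∃ x ∈ S, q x = y
  q_ker : ∀ x, x ∈ S → (q x = 0 ↔ x ∈ Z)

/-- The data exhibiting `φ : A → B` as DG quasi-smooth, relative to a realization
`E` of the enveloping DG algebra `B^e` and the multiplication map `π_B : B^e → B`:
`B` is graded-free over `A` and the diagonal ideal `J = ker π_B` carries a filtration
`J = J^[1] ⊇ J^[2] ⊇ ⋯` of DG `B^e`-submodules with `J·J^[ℓ] + J^[ℓ]·J ⊆ J^[ℓ+1]`,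
`inf J^[ℓ] ≥ ℓ`, and all subquotients `J^[ℓ]/J^[ℓ+1]` semifree over `B`. -/
structure QuasiSmoothData {A B : DGAlgebra R} (φ : DGAlgHom A B) (E : DGAlgebra R)
    (he : EnvelopingAlg φ E) (πB : DGAlgHom E B) where
  pil : ∀ b, πB.toFun (he.l.toFun b) = b
  pir : ∀ b, πB.toFun (he.r.toFun b) = b
  free : FreeOverBase φ
  filt : ℕ → Set E.carrier
  filt_one : filt 1 = {x | πB.toFun x = 0}
  filt_desc : ∀ ℓ, 1 ≤ ℓ → filt (ℓ + 1) ⊆ filt ℓ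
  filt_zero : ∀ ℓ, (0 : E.carrier) ∈ filt ℓ
  filt_add : ∀ ℓ x y, x ∈ filt ℓ → y ∈ filt ℓ → x + y ∈ filt ℓ
  filt_neg : ∀ ℓ x, x ∈ filt ℓ → -x ∈ filt ℓ
  filt_rsmul : ∀ ℓ (r : R) x, x ∈ filt ℓ → r • x ∈ filt ℓ
  filt_act : ∀ ℓ (e : E.carrier) x, x ∈ filt ℓ → x * e ∈ filt ℓ
  filt_d : ∀ ℓ x, x ∈ filt ℓ → E.d x ∈ filt ℓ
  filt_graded : ∀ ℓ x, x ∈ filt ℓ →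
    x ∈ Submodule.span R (filt ℓ ∩ ⋃ i : ℤ, (E.grading i : Set E.carrier))
  filt_mul : ∀ ℓ, 1 ≤ ℓ → ∀ a x, πB.toFun a = 0 → x ∈ filt ℓ →
    a * x ∈ filt (ℓ + 1) ∧ x * a ∈ filt (ℓ + 1)
  filt_inf : ∀ ℓ : ℕ, 1 ≤ ℓ → ∀ i : ℤ, i < (ℓ : ℤ) →
    ∀ x ∈ filt ℓ, x ∈ E.grading i → x = 0
  quot_semifree : ∀ ℓ, 1 ≤ ℓ → ∃ Q : DGModule R B,
    Nonempty (SubquotModSpec he (filt ℓ) (filt (ℓ + 1)) Q) ∧ IsSemifree Q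

/-- The data exhibiting `φ : A → B` as DG smooth: quasi-smooth, and all
subquotients `J^[ℓ]/J^[ℓ+1]` have finite semifree bases. -/
structure SmoothData {A B : DGAlgebra R} (φ : DGAlgHom A B) (E : DGAlgebra R)
    (he : EnvelopingAlg φ E) (πB : DGAlgHom E B)
    extends QuasiSmoothData φ E he πB where
  quot_finite : ∀ ℓ, 1 ≤ ℓ → ∃ Q : DGModule R B,
    Nonempty (SubquotModSpec he (filt ℓ) (filt (ℓ + 1)) Q) ∧ HasFiniteSemifreeBasis Q

/-- A DG `A`-submodule of a DG `A`-module `M`: an `R`-submodule closed under the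
`A`-action and the differential and generated by homogeneous elements. -/
structure DGSubmodule {A : DGAlgebra R} (M : DGModule R A) where
  toSubmodule : Submodule R M.carrier
  smul_mem' : ∀ (x : M.carrier) (a : A.carrier), x ∈ toSubmodule →
    M.smul x a ∈ toSubmodule
  d_mem' : ∀ x ∈ toSubmodule, M.d x ∈ toSubmodule
  graded' : ∀ x ∈ toSubmodule, x ∈ Submodule.span R
    ((toSubmodule : Set M.carrier) ∩ ⋃ i : ℤ, (M.grading i : Set M.carrier))

/-- `P` (with projections `proj`) is the direct product of the family `Ms` in the
category of DG `A`-modules. -/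
def IsDGProduct {A : DGAlgebra R} (Ms : ℕ → DGModule R A) (P : DGModule R A)
    (proj : ∀ ℓ, DGHom P (Ms ℓ)) : Prop :=
  ∀ (W : DGModule R A) (f : ∀ ℓ, DGHom W (Ms ℓ)),
    ∃ g : DGHom W P, (∀ ℓ x, (proj ℓ).toFun (g.toFun x) = (f ℓ).toFun x) ∧
      ∀ g' : DGHom W P, (∀ ℓ x, (proj ℓ).toFun (g'.toFun x) = (f ℓ).toFun x) →
        ∀ x, g'.toFun x = g.toFun x

/-- `M'` is the `k`-th shift `Σ^k M` of the DG `A`-module `M`. -/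
structure DGShiftSpec {A : DGAlgebra R} (k : ℤ) (M M' : DGModule R A) where
  toFun : M.carrier → M'.carrier
  bij : Function.Bijective toFun
  map_add : ∀ x y, toFun (x + y) = toFun x + toFun y
  map_rsmul : ∀ (r : R) x, toFun (r • x) = r • toFun x
  map_mem : ∀ {i : ℤ} (x : M.carrier), x ∈ M.grading i → toFun x ∈ M'.grading (i + k)
  map_smul : ∀ (x : M.carrier) (a : A.carrier), toFun (M.smul x a) = M'.smul (toFun x) a
  map_d : ∀ x, M'.d (toFun x) = ksign k • toFun (M.d x)

/-- `C` is the mapping cone of `f : X → Y`: a degreewise split extension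
`0 → Y → C → ΣX → 0` whose twisting term is `f`. -/
structure DGConeSpec {A : DGAlgebra R} {X Y : DGModule R A} (f : DGHom X Y)
    (C : DGModule R A) where
  inl : DGHom Y C
  inl_inj : Function.Injective inl.toFun
  pr : GradedHom C X (-1)
  pr_d : ∀ c, pr.toFun (C.d c) = - X.d (pr.toFun c)
  sec : GradedHom X C 1
  pr_sec : ∀ x, pr.toFun (sec.toFun x) = x
  pr_inl : ∀ y, pr.toFun (inl.toFun y) = 0
  split : ∀ c, ∃ y, c = inl.toFun y + sec.toFun (pr.toFun c)
  sec_d : ∀ x, C.d (sec.toFun x) = - sec.toFun (X.d x) + inl.toFun (f.toFun x)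

/-- A system of divided powers on (the homogeneous elements of positive even degree
of) a DG `R`-algebra. -/
structure DGDividedPowers (A : DGAlgebra R) where
  dpow : ℕ → A.carrier → A.carrier
  dpow_zero : ∀ {i : ℤ} (u : A.carrier), 0 < i → Even i → u ∈ A.grading i →
    dpow 0 u = 1
  dpow_one : ∀ {i : ℤ} (u : A.carrier), 0 < i → Even i → u ∈ A.grading i →
    dpow 1 u = u
  dpow_mem : ∀ {i : ℤ} (u : A.carrier) (m : ℕ), 0 < i → Even i → u ∈ A.grading i →
    dpow m u ∈ A.grading ((m : ℤ) * i)
  dpow_mul : ∀ {i : ℤ} (u : A.carrier) (m l : ℕ), 0 < i → Even i → u ∈ A.grading i →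
    dpow m u * dpow l u = ((m + l).choose m : ℤ) • dpow (m + l) u
  dpow_add : ∀ {i : ℤ} (u v : A.carrier) (m : ℕ), 0 < i → Even i →
    u ∈ A.grading i → v ∈ A.grading i →
    dpow m (u + v) = ∑ j ∈ Finset.range (m + 1), dpow j u * dpow (m - j) v
  dpow_odd_mul : ∀ {i j : ℤ} (u v : A.carrier) (m : ℕ), Odd i → Odd j →
    u ∈ A.grading i → v ∈ A.grading j → 2 ≤ m → dpow m (u * v) = 0
  dpow_even_mul : ∀ {i j : ℤ} (u v : A.carrier) (m : ℕ), Even i → Even j → 0 < j →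
    u ∈ A.grading i → v ∈ A.grading j → dpow m (u * v) = u ^ m * dpow m v
  dpow_comp : ∀ {i : ℤ} (u : A.carrier) (m l : ℕ), 0 < i → Even i →
    u ∈ A.grading i → 1 ≤ m →
    dpow l (dpow m u) =
      (Nat.factorial (m * l) / (Nat.factorial l * (Nat.factorial m) ^ l)) •
        dpow (m * l) u

/-- The index set of monomials in variables `ι` (with divided/ordinary powers):
finitely supported exponent functions, with exponents at most `1` on odd-degree
variables. -/
def MonIdx (ι : Type) (degX : ι → ℤ) : Type :=
  {m : ι →₀ ℕ // ∀ i, Odd (degX i) → m i ≤ 1}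

/-- Total weight (number of symbols) of a monomial index. -/
def monWeight {ι : Type} {degX : ι → ℤ} (m : MonIdx ι degX) : ℕ :=
  m.1.sum fun _ k => k

/-- The monomial `∏_i g i (m i)` (product taken in the increasing order of the
variables). -/
def gradMonomial {T : Type} [Ring T] {ι : Type} [LinearOrder ι] (degX : ι → ℤ)
    (g : ι → ℕ → T) (m : MonIdx ι degX) : T :=
  ((m.1.support.sort (· ≤ ·)).map fun i => g i (m.1 i)).prod

/-- `B = A[X_i : i ∈ ι]` is a polynomial extension of `A` by the variables `X_i`
of positive degrees `degX i`, adjoined in increasing order of degree, each `d X_i`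
lying in the preceding stage; the monomials in the `X_i` form a basis of `B` as a
graded `A`-module. -/
structure PolyExt {A B : DGAlgebra R} (φ : DGAlgHom A B) (ι : Type) [LinearOrder ι]
    (X : ι → B.carrier) (degX : ι → ℤ) where
  inj : Function.Injective φ.toFun
  pos_deg : ∀ i, 0 < degX i
  mono_deg : Monotone degX
  homog : ∀ i, X i ∈ B.grading (degX i)
  d_prev : ∀ i : ι, ∃ c : MonIdx ι degX →₀ A.carrier,
    (∀ m ∈ c.support, ∀ j : ι, i ≤ j → m.1 j = 0) ∧
    B.d (X i) = c.sum fun m a =>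
      gradMonomial degX (fun i' k => X i' ^ k) m * φ.toFun a
  basis : Function.Bijective (fun c : MonIdx ι degX →₀ A.carrier =>
    c.sum fun m a => gradMonomial degX (fun i' k => X i' ^ k) m * φ.toFun a)

/-- `B = A⟨X_i : i ∈ ι⟩` is a free (divided power) extension of `A` by the
variables `X_i` of positive degrees: odd variables square to zero, even variables
carry divided powers `dp i m` with `d(X^{(m)}) = X^{(m-1)} dX`, and the divided
power monomials form a basis of `B` as a graded `A`-module. -/
structure FreeExt {A B : DGAlgebra R} (φ : DGAlgHom A B) (ι : Type) [LinearOrder ι]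
    (X : ι → B.carrier) (degX : ι → ℤ) where
  inj : Function.Injective φ.toFun
  pos_deg : ∀ i, 0 < degX i
  mono_deg : Monotone degX
  homog : ∀ i, X i ∈ B.grading (degX i)
  dp : ι → ℕ → B.carrier
  dp_zero : ∀ i, dp i 0 = 1
  dp_one : ∀ i, dp i 1 = X i
  dp_odd : ∀ i m, Odd (degX i) → 2 ≤ m → dp i m = 0
  dp_mem : ∀ i (m : ℕ), dp i m ∈ B.grading ((m : ℤ) * degX i)
  dp_mul : ∀ i (m l : ℕ), dp i m * dp i l = ((m + l).choose m : ℤ) • dp i (m + l)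
  dp_d : ∀ i (m : ℕ), 1 ≤ m → B.d (dp i m) = dp i (m - 1) * B.d (X i)
  d_prev : ∀ i : ι, ∃ c : MonIdx ι degX →₀ A.carrier,
    (∀ m ∈ c.support, ∀ j : ι, i ≤ j → m.1 j = 0) ∧
    B.d (X i) = c.sum fun m a => gradMonomial degX dp m * φ.toFun a
  basis : Function.Bijective (fun c : MonIdx ι degX →₀ A.carrier =>
    c.sum fun m a => gradMonomial degX dp m * φ.toFun a)

/-- The diagonal `ξ_i = X_i^o ⊗ 1 - 1^o ⊗ X_i` of the variable `X_i` in `B^e`. -/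
def xiDiag {A B E : DGAlgebra R} {φ : DGAlgHom A B} (he : EnvelopingAlg φ E)
    {ι : Type} (X : ι → B.carrier) (i : ι) : E.carrier :=
  he.l.toFun (X i) - he.r.toFun (X i)

/-- The divided powers `ξ_i^{(m)} = Σ_{j=0}^m (-1)^{m-j} (X_i^{(j)})^o ⊗ X_i^{(m-j)}`
of the diagonal `ξ_i` in `B^e` (zero for `m ≥ 2` when `|X_i|` is odd). -/
def xiDp {A B E : DGAlgebra R} {φ : DGAlgHom A B} (he : EnvelopingAlg φ E)
    {ι : Type} (dp : ι → ℕ → B.carrier) (degX : ι → ℤ) (i : ι) (m : ℕ) :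
    E.carrier :=
  if Odd (degX i) ∧ 2 ≤ m then 0
  else ∑ j ∈ Finset.range (m + 1),
    ((-1 : ℤ) ^ (m - j)) • (he.l.toFun (dp i j) * he.r.toFun (dp i (m - j)))

/-- The monomial `ξ^{(m)} = ξ_{i_1}^{(m_{i_1})} ⋯ ξ_{i_t}^{(m_{i_t})}` in `B^e`
built from the divided powers of the diagonals. -/
def FreeExt.diagMon {A B E : DGAlgebra R} {φ : DGAlgHom A B}
    {ι : Type} [LinearOrder ι] {X : ι → B.carrier} {degX : ι → ℤ}
    (fe : FreeExt φ ι X degX) (he : EnvelopingAlg φ E) (m : MonIdx ι degX) :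
    E.carrier :=
  gradMonomial degX (xiDp he fe.dp degX) m

/-- The `ℓ`-th power `J^{(ℓ)} = Mon_{≥ℓ}(Ω)·B^e` of the diagonal ideal:
right `B^e`-linear combinations of the `ξ`-monomials of weight at least `ℓ`. -/
def FreeExt.diagPow {A B E : DGAlgebra R} {φ : DGAlgHom A B}
    {ι : Type} [LinearOrder ι] {X : ι → B.carrier} {degX : ι → ℤ}
    (fe : FreeExt φ ι X degX) (he : EnvelopingAlg φ E) (ℓ : ℕ) :
    Set E.carrier :=
  {x | ∃ c : MonIdx ι degX →₀ E.carrier, (∀ m ∈ c.support, ℓ ≤ monWeight m) ∧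
    x = c.sum fun m e => fe.diagMon he m * e}

/-- Ordinary-power analogue `J^ℓ` for polynomial extensions. -/
def PolyExt.diagPow {A B E : DGAlgebra R} {φ : DGAlgHom A B}
    {ι : Type} [LinearOrder ι] {X : ι → B.carrier} {degX : ι → ℤ}
    (_ : PolyExt φ ι X degX) (he : EnvelopingAlg φ E) (ℓ : ℕ) :
    Set E.carrier :=
  {x | ∃ c : MonIdx ι degX →₀ E.carrier, (∀ m ∈ c.support, ℓ ≤ monWeight m) ∧
    x = c.sum fun m e =>
      gradMonomial degX (fun i k => (xiDiag he X i) ^ k) m * e}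

/-- Additive closure of the set of products `a * b` with `a ∈ S₁`, `b ∈ S₂`. -/
def setMulClosure {T : Type} [Ring T] (S₁ S₂ : Set T) : Set T :=
  (AddSubmonoid.closure {x | ∃ a ∈ S₁, ∃ b ∈ S₂, x = a * b} : AddSubmonoid T)

/-- The right ideal generated by a set. -/
def rightIdealGen {T : Type} [Ring T] (S : Set T) : Set T :=
  (AddSubmonoid.closure {x | ∃ s ∈ S, ∃ e : T, x = s * e} : AddSubmonoid T)

/-- The two-sided ideal generated by a set. -/
def twoSidedGen {T : Type} [Ring T] (S : Set T) : Set T :=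
  (AddSubmonoid.closure {x | ∃ s ∈ S, ∃ e e' : T, x = e * s * e'} : AddSubmonoid T)

end


noncomputable section

theorem ksign_add (i j : ℤ) : ksign (i + j) = ksign i * ksign j := by
  simp [ksign, zpow_add]

@[simp] theorem ksign_zero : ksign 0 = 1 := by simp [ksign]

@[simp] theorem ksign_one : ksign 1 = -1 := by simp [ksign]

theorem ksign_mul_self (i : ℤ) : ksign i * ksign i = 1 := by
  rw [ksign, ← Units.val_mul, Int.units_mul_self, Units.val_one]

theorem ksign_of_even {i : ℤ} (h : Even i) : ksign i = 1 := by
  obtain ⟨k, rfl⟩ := h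
  rw [ksign_add, ksign_mul_self]

theorem ksign_congr {i j : ℤ} (h : Even (i - j)) : ksign i = ksign j := by
  rw [← sub_add_cancel i j, ksign_add, ksign_of_even h, one_mul]

theorem ksign_smul_smul {M : Type*} [AddCommGroup M] (i : ℤ) (x : M) :
    ksign i • ksign i • x = x := by
  rw [smul_smul, ksign_mul_self, one_smul]

variable {R : Type} [CommRing R]

/-- A family of submodules indexed by `ℤ` is a grading: its members are independent and span. -/
structure IsGrading {M : Type} [AddCommGroup M] [Module R M] (G : ℤ → Submodule R M) : Prop where
  indep : iSupIndep G
  spanning : (⨆ i, G i) = ⊤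

namespace IsGrading

variable {M M' : Type} [AddCommGroup M] [Module R M] [AddCommGroup M'] [Module R M']
  {G : ℤ → Submodule R M} (hG : IsGrading G)
include hG

theorem bijective_coeLinearMap : Function.Bijective (DirectSum.coeLinearMap G) :=
  DirectSum.isInternal_submodule_of_iSupIndep_of_iSup_eq_top hG.indep hG.spanning

/-- The linear map which agrees with `f i` on the component of degree `i`. -/
def lift (f : ℤ → M →ₗ[R] M') : M →ₗ[R] M' :=
  (DirectSum.toModule R ℤ M' fun i => (f i).comp (G i).subtype).comp
    (LinearEquiv.ofBijective (DirectSum.coeLinearMap G) hG.bijective_coeLinearMap).symm.toLinearMap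

theorem lift_of_mem (f : ℤ → M →ₗ[R] M') {i : ℤ} {x : M} (hx : x ∈ G i) :
    hG.lift f x = f i x := by
  have : (LinearEquiv.ofBijective (DirectSum.coeLinearMap G) hG.bijective_coeLinearMap).symm x =
      DirectSum.lof R ℤ (fun i => G i) i ⟨x, hx⟩ := by
    rw [LinearEquiv.symm_apply_eq]
    simp
  simp [lift, this]

@[elab_as_elim]
theorem induction {p : M → Prop} (x : M) (mem : ∀ i, ∀ x ∈ G i, p x) (zero : p 0)
    (add : ∀ x y, p x → p y → p (x + y)) : p x :=
  Submodule.iSup_induction G (motive := p) (x := x) (by rw [hG.spanning]; trivial) mem zero add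

theorem hom_ext {f g : M →ₗ[R] M'} (h : ∀ i, ∀ x ∈ G i, f x = g x) : f = g := by
  ext x
  refine hG.induction x h (by simp) fun x y hx hy => ?_
  rw [map_add, map_add, hx, hy]

/-- The projection onto the component of degree `i`. -/
def proj (i : ℤ) : M →ₗ[R] M := hG.lift fun j => if j = i then LinearMap.id else 0

theorem proj_of_mem {i : ℤ} {x : M} (hx : x ∈ G i) : hG.proj i x = x := by
  simp [proj, hG.lift_of_mem _ hx]

theorem proj_of_mem_ne {i j : ℤ} (h : j ≠ i) {x : M} (hx : x ∈ G j) : hG.proj i x = 0 := by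
  simp [proj, hG.lift_of_mem _ hx, h]

theorem proj_mem (i : ℤ) (x : M) : hG.proj i x ∈ G i := by
  refine hG.induction x (fun j x hx => ?_) (by simp) fun x y hx hy => ?_
  · rcases eq_or_ne j i with rfl | h
    · rwa [hG.proj_of_mem hx]
    · rw [hG.proj_of_mem_ne h hx]; exact zero_mem _
  · rw [map_add]; exact add_mem hx hy

/-- The operator which multiplies the component of degree `i` by `(-1)^{ij}`. -/
def sgn (j : ℤ) : M →ₗ[R] M := hG.lift fun i => ksign (i * j) • LinearMap.id

theorem sgn_of_mem (j : ℤ) {i : ℤ} {x : M} (hx : x ∈ G i) :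
    hG.sgn j x = ksign (i * j) • x := by
  simp [sgn, hG.lift_of_mem _ hx]

theorem sgn_mem (j : ℤ) {i : ℤ} {x : M} (hx : x ∈ G i) : hG.sgn j x ∈ G i := by
  rw [hG.sgn_of_mem j hx]; exact zsmul_mem hx _

theorem sgn_sgn (j : ℤ) (x : M) : hG.sgn j (hG.sgn j x) = x := by
  refine hG.induction x (fun i x hx => ?_) (by simp) fun x y hx hy => ?_
  · rw [hG.sgn_of_mem j hx, map_zsmul, hG.sgn_of_mem j hx, ksign_smul_smul]
  · rw [map_add, map_add, hx, hy]

theorem sgn_comm (i j : ℤ) (x : M) : hG.sgn i (hG.sgn j x) = hG.sgn j (hG.sgn i x) := by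
  refine hG.induction x (fun k x hx => ?_) (by simp) fun x y hx hy => ?_
  · rw [hG.sgn_of_mem j hx, hG.sgn_of_mem i hx, map_zsmul, map_zsmul, hG.sgn_of_mem j hx,
      hG.sgn_of_mem i hx, smul_comm]
  · simp only [map_add, hx, hy]

omit hG in
theorem of_proj (P : ℤ → M →ₗ[R] M) (hP : ∀ i, ∀ x ∈ G i, P i x = x)
    (hP' : ∀ i j, j ≠ i → ∀ x ∈ G j, P i x = 0) (h : (⨆ i, G i) = ⊤) : IsGrading G where
  spanning := h
  indep i := by
    rw [Submodule.disjoint_def]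
    intro x hx hx'
    have : (⨆ j, ⨆ (_ : j ≠ i), G j) ≤ LinearMap.ker (P i) :=
      iSup₂_le fun j hj y hy => hP' i j hj y hy
    rw [← hP i x hx]
    exact this hx'

end IsGrading

namespace DGAlgebra

variable (A : DGAlgebra R)

theorem isGrading : IsGrading A.grading := ⟨A.indep, A.spanning⟩

/-- The differential as a linear map. -/
def dL : A.carrier →ₗ[R] A.carrier where
  toFun := A.d
  map_add' := A.d_add
  map_smul' := A.d_rsmul

@[simp] theorem dL_apply (a : A.carrier) : A.dL a = A.d a := rfl

@[simp] theorem d_zero : A.d 0 = 0 := map_zero A.dL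

/-- The sign operator `a ↦ (-1)^{j|a|} a`. -/
def sg (j : ℤ) : A.carrier →ₗ[R] A.carrier := A.isGrading.sgn j

theorem sg_of_mem (j : ℤ) {i : ℤ} {a : A.carrier} (ha : a ∈ A.grading i) :
    A.sg j a = ksign (i * j) • a := A.isGrading.sgn_of_mem j ha

theorem d_one : A.d 1 = 0 := by
  have h := A.leibniz (1 : A.carrier) 1 A.one_mem
  simpa using h

theorem proj_mul (n : ℤ) {i : ℤ} {a : A.carrier} (ha : a ∈ A.grading i) (b : A.carrier) :
    A.isGrading.proj n (a * b) = a * A.isGrading.proj (n - i) b := by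
  refine A.isGrading.induction b (fun j b hb => ?_) (by simp) fun x y hx hy => ?_
  · rcases eq_or_ne j (n - i) with rfl | h
    · rw [A.isGrading.proj_of_mem hb, A.isGrading.proj_of_mem]
      simpa using A.mul_mem ha hb
    · rw [A.isGrading.proj_of_mem_ne h hb, mul_zero,
        A.isGrading.proj_of_mem_ne _ (A.mul_mem ha hb)]
      contrapose! h
      linarith
  · rw [mul_add, map_add, hx, hy, map_add, mul_add]

end DGAlgebra

namespace DGModule

variable {A : DGAlgebra R} (M : DGModule R A)

theorem isGrading : IsGrading M.grading := ⟨M.indep, M.spanning⟩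

/-- The action as a bilinear map. -/
def smulL : M.carrier →ₗ[R] A.carrier →ₗ[R] M.carrier :=
  LinearMap.mk₂ R M.smul M.add_smul M.rsmul_smul M.smul_add M.smul_rsmul

@[simp] theorem smulL_apply (m : M.carrier) (a : A.carrier) : M.smulL m a = M.smul m a := rfl

/-- The differential as a linear map. -/
def dL : M.carrier →ₗ[R] M.carrier where
  toFun := M.d
  map_add' := M.d_add
  map_smul' := M.d_rsmul

@[simp] theorem dL_apply (m : M.carrier) : M.dL m = M.d m := rfl

@[simp] theorem d_zero : M.d 0 = 0 := map_zero M.dL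

theorem d_sub (m n : M.carrier) : M.d (m - n) = M.d m - M.d n := map_sub M.dL m n

theorem d_zsmul (n : ℤ) (m : M.carrier) : M.d (n • m) = n • M.d m := map_zsmul M.dL n m

@[simp] theorem smul_zero (m : M.carrier) : M.smul m 0 = 0 := map_zero (M.smulL m)

@[simp] theorem zero_smul (a : A.carrier) : M.smul 0 a = 0 := M.smulL.map_zero₂ a

theorem smul_zsmul (n : ℤ) (m : M.carrier) (a : A.carrier) :
    M.smul m (n • a) = n • M.smul m a := map_zsmul (M.smulL m) n a

theorem zsmul_smul (n : ℤ) (m : M.carrier) (a : A.carrier) :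
    M.smul (n • m) a = n • M.smul m a := map_zsmul (M.smulL.flip a) n m

theorem sub_smul (m n : M.carrier) (a : A.carrier) :
    M.smul (m - n) a = M.smul m a - M.smul n a := map_sub (M.smulL.flip a) m n

/-- The sign operator `m ↦ (-1)^{j|m|} m`. -/
def sg (j : ℤ) : M.carrier →ₗ[R] M.carrier := M.isGrading.sgn j

theorem sg_of_mem (j : ℤ) {i : ℤ} {m : M.carrier} (hm : m ∈ M.grading i) :
    M.sg j m = ksign (i * j) • m := M.isGrading.sgn_of_mem j hm

theorem sg_mem (j : ℤ) {i : ℤ} {m : M.carrier} (hm : m ∈ M.grading i) :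
    M.sg j m ∈ M.grading i := M.isGrading.sgn_mem j hm

theorem sg_smul (j : ℤ) (m : M.carrier) (a : A.carrier) :
    M.sg j (M.smul m a) = M.smul (M.sg j m) (A.sg j a) := by
  refine M.isGrading.induction m (fun i m hm => ?_) (by simp) fun x y hx hy => ?_
  · refine A.isGrading.induction a (fun k a ha => ?_) (by simp) fun x y hx hy => ?_
    · rw [M.sg_of_mem j (M.smul_mem hm ha), M.sg_of_mem j hm, A.sg_of_mem j ha, M.zsmul_smul,
        M.smul_zsmul, smul_smul, add_mul, ksign_add]
    · simp only [M.smul_add, map_add, hx, hy]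
  · simp only [M.add_smul, map_add, hx, hy]

theorem sg_d (j : ℤ) (m : M.carrier) : M.sg j (M.d m) = ksign j • M.d (M.sg j m) := by
  refine M.isGrading.induction m (fun i m hm => ?_) (by simp) fun x y hx hy => ?_
  · rw [M.sg_of_mem j (M.d_mem hm), M.sg_of_mem j hm, M.d_zsmul, smul_smul, ← ksign_add]
    congr 1
    exact ksign_congr ⟨-j, by ring⟩
  · simp only [M.d_add, map_add, hx, hy, _root_.smul_add]

theorem d_smul (m : M.carrier) (a : A.carrier) :
    M.d (M.smul m a) = M.smul (M.d m) a + M.smul (M.sg 1 m) (A.d a) := by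
  refine M.isGrading.induction m (fun i m hm => ?_) (by simp) fun x y hx hy => ?_
  · rw [M.leibniz m a hm, M.sg_of_mem 1 hm, mul_one, M.zsmul_smul]
  · simp only [M.add_smul, map_add, M.d_add, hx, hy]; abel

end DGModule

end

noncomputable section

open scoped TensorProduct

variable {R : Type} [CommRing R]

namespace BaseChange

variable {A B : DGAlgebra R} (φ : DGAlgHom A B) (M : DGModule R A)

/-- The relations `ma ⊗ b = m ⊗ φ(a)b`. -/
def rel : Submodule R (M.carrier ⊗[R] B.carrier) :=
  Submodule.span R {z | ∃ m a b, z = M.smul m a ⊗ₜ[R] b - m ⊗ₜ[R] (φ.toFun a * b)}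

/-- The tensor product `M ⊗_A B`. -/
def Carrier : Type := (M.carrier ⊗[R] B.carrier) ⧸ rel φ M

instance : AddCommGroup (Carrier φ M) :=
  inferInstanceAs (AddCommGroup ((M.carrier ⊗[R] B.carrier) ⧸ rel φ M))

instance : Module R (Carrier φ M) :=
  inferInstanceAs (Module R ((M.carrier ⊗[R] B.carrier) ⧸ rel φ M))

/-- The class of `m ⊗ b`. -/
def tmul : M.carrier →ₗ[R] B.carrier →ₗ[R] Carrier φ M :=
  (TensorProduct.mk R M.carrier B.carrier).compr₂ (rel φ M).mkQ

variable {φ M}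

theorem tmul_smul (m : M.carrier) (a : A.carrier) (b : B.carrier) :
    tmul φ M (M.smul m a) b = tmul φ M m (φ.toFun a * b) :=
  (Submodule.Quotient.eq _).mpr (Submodule.subset_span ⟨m, a, b, rfl⟩)

/-- The linear map out of `M ⊗_A B` induced by a balanced bilinear map. -/
def lift {W : Type} [AddCommGroup W] [Module R W] (f : M.carrier →ₗ[R] B.carrier →ₗ[R] W)
    (hf : ∀ m a b, f (M.smul m a) b = f m (φ.toFun a * b)) : Carrier φ M →ₗ[R] W :=
  (rel φ M).liftQ (TensorProduct.lift f) <| by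
    rw [rel, Submodule.span_le]
    rintro _ ⟨m, a, b, rfl⟩
    simp [hf]

@[simp] theorem lift_tmul {W : Type} [AddCommGroup W] [Module R W]
    (f : M.carrier →ₗ[R] B.carrier →ₗ[R] W)
    (hf : ∀ m a b, f (M.smul m a) b = f m (φ.toFun a * b)) (m : M.carrier) (b : B.carrier) :
    lift f hf (tmul φ M m b) = f m b :=
  TensorProduct.lift.tmul m b

@[elab_as_elim]
theorem induction {p : Carrier φ M → Prop} (z : Carrier φ M)
    (tmul : ∀ i j m b, m ∈ M.grading i → b ∈ B.grading j → p (tmul φ M m b)) (zero : p 0)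
    (add : ∀ x y, p x → p y → p (x + y)) : p z := by
  obtain ⟨t, rfl⟩ := Submodule.Quotient.mk_surjective _ z
  induction t with
  | zero => exact zero
  | add x y hx hy => exact add _ _ hx hy
  | tmul m b =>
    change p (BaseChange.tmul φ M m b)
    refine M.isGrading.induction m (fun i m hm => ?_) (by simpa using zero) fun x y hx hy => ?_
    · refine B.isGrading.induction b (fun j b hb => tmul i j m b hm hb) (by simpa using zero)
        fun x y hx hy => ?_
      rw [map_add]; exact add _ _ hx hy
    · rw [LinearMap.map_add₂]; exact add _ _ hx hy

theorem hom_ext {W : Type} [AddCommGroup W] [Module R W] {f g : Carrier φ M →ₗ[R] W}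
    (h : ∀ m b, f (tmul φ M m b) = g (tmul φ M m b)) : f = g := by
  ext z
  refine induction z (fun i j m b _ _ => h m b) (by simp) fun x y hx hy => ?_
  rw [map_add, map_add, hx, hy]

variable (φ M)

/-- The component of degree `n` of `M ⊗_A B`. -/
def grading (n : ℤ) : Submodule R (Carrier φ M) :=
  Submodule.span R {z | ∃ i j m b, i + j = n ∧ m ∈ M.grading i ∧ b ∈ B.grading j ∧
    z = tmul φ M m b}

variable {φ M}

theorem tmul_mem {i j : ℤ} {m : M.carrier} {b : B.carrier} (hm : m ∈ M.grading i)
    (hb : b ∈ B.grading j) : tmul φ M m b ∈ grading φ M (i + j) :=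
  Submodule.subset_span ⟨i, j, m, b, rfl, hm, hb, rfl⟩

theorem map_mem_of_tmul {W : Type} [AddCommGroup W] [Module R W] (f : Carrier φ M →ₗ[R] W)
    (S : Submodule R W) {n : ℤ} (h : ∀ i j m b, i + j = n → m ∈ M.grading i → b ∈ B.grading j →
      f (tmul φ M m b) ∈ S) {z : Carrier φ M} (hz : z ∈ grading φ M n) : f z ∈ S := by
  have : grading φ M n ≤ S.comap f := by
    rw [grading, Submodule.span_le]
    rintro _ ⟨i, j, m, b, hij, hm, hb, rfl⟩
    exact h i j m b hij hm hb
  exact this hz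

variable (φ M)

/-- The bilinear map underlying the projection onto the component of degree `n`. -/
def projBil (n : ℤ) : M.carrier →ₗ[R] B.carrier →ₗ[R] Carrier φ M :=
  M.isGrading.lift fun i => (tmul φ M).compl₂ (B.isGrading.proj (n - i))

theorem projBil_of_mem (n : ℤ) {i : ℤ} {m : M.carrier} (hm : m ∈ M.grading i) (b : B.carrier) :
    projBil φ M n m b = tmul φ M m (B.isGrading.proj (n - i) b) := by
  rw [projBil, M.isGrading.lift_of_mem _ hm]; rfl

theorem projBil_balanced (n : ℤ) (m : M.carrier) (a : A.carrier) (b : B.carrier) :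
    projBil φ M n (M.smul m a) b = projBil φ M n m (φ.toFun a * b) := by
  refine M.isGrading.induction m (fun i m hm => ?_) (by simp) fun x y hx hy => ?_
  · refine A.isGrading.induction a (fun k a ha => ?_) ?_ fun x y hx hy => ?_
    · rw [projBil_of_mem φ M n (M.smul_mem hm ha), projBil_of_mem φ M n hm, tmul_smul,
        B.proj_mul _ (φ.map_mem ha), sub_sub]
    · have : φ.toFun 0 = 0 := by simpa using φ.map_rsmul 0 0
      simp [this]
    · simp only [M.smul_add, map_add, φ.map_add, add_mul, LinearMap.add_apply, hx, hy]
  · simp only [M.add_smul, map_add, LinearMap.add_apply, hx, hy]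

theorem isGrading : IsGrading (grading φ M) := by
  refine IsGrading.of_proj (fun n => lift (projBil φ M n) (projBil_balanced φ M n))
    (fun n z hz => ?_) (fun n k hk z hz => ?_) ?_
  · rw [← sub_eq_zero]
    refine (Submodule.mem_bot R).mp (map_mem_of_tmul (lift (projBil φ M n)
      (projBil_balanced φ M n) - LinearMap.id) ⊥ (fun i j m b hij hm hb => ?_) hz)
    obtain rfl : j = n - i := by linarith
    simp [projBil_of_mem φ M n hm, B.isGrading.proj_of_mem hb]
  · refine (Submodule.mem_bot R).mp (map_mem_of_tmul _ ⊥ (fun i j m b hij hm hb => ?_) hz)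
    have : j ≠ n - i := by contrapose! hk; linarith
    simp [projBil_of_mem φ M n hm, B.isGrading.proj_of_mem_ne this hb]
  · refine (Submodule.eq_top_iff').mpr fun z => ?_
    refine induction z (fun i j m b hm hb => ?_) (zero_mem _) fun x y hx hy => add_mem hx hy
    exact Submodule.mem_iSup_of_mem (i + j) (tmul_mem hm hb)

/-- The right action of `B` on `M ⊗_A B`. -/
def act : Carrier φ M →ₗ[R] B.carrier →ₗ[R] Carrier φ M :=
  (LinearMap.mk₂ R (fun b z => lift (φ := φ) (M := M) ((tmul φ M).compl₂ (LinearMap.mulRight R b))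
    (fun m a b' => by simp [tmul_smul, mul_assoc]) z)
    (fun b b' z => by
      rw [← LinearMap.add_apply]; congr 1; refine hom_ext fun m c => ?_; simp [mul_add])
    (fun r b z => by
      rw [← LinearMap.smul_apply]; congr 1; refine hom_ext fun m c => ?_; simp)
    (fun b z z' => map_add _ _ _)
    (fun r b z => map_smul _ _ _)).flip

@[simp] theorem act_tmul (m : M.carrier) (b b' : B.carrier) :
    act φ M (tmul φ M m b) b' = tmul φ M m (b * b') := by
  rw [act, LinearMap.flip_apply, LinearMap.mk₂_apply, lift_tmul]
  rfl

/-- The differential of `M ⊗_A B`. -/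
def diff : Carrier φ M →ₗ[R] Carrier φ M :=
  lift ((tmul φ M).comp M.dL + ((tmul φ M).comp (M.sg 1)).compl₂ B.dL) fun m a b => by
    have h : φ.toFun (A.sg 1 a) = B.sg 1 (φ.toFun a) := by
      refine A.isGrading.induction a (fun k a ha => ?_) ?_ fun x y hx hy => ?_
      · rw [A.sg_of_mem 1 ha, B.sg_of_mem 1 (φ.map_mem ha)]
        exact map_zsmul (AddMonoidHom.mk' φ.toFun φ.map_add) _ _
      · have : φ.toFun 0 = 0 := by simpa using φ.map_rsmul 0 0
        simp [this]
      · simp only [map_add, φ.map_add, hx, hy]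
    have hl : B.d (φ.toFun a * b) = B.d (φ.toFun a) * b + B.sg 1 (φ.toFun a) * B.d b := by
      refine B.isGrading.induction (φ.toFun a) (fun k a ha => ?_) (by simp) fun x y hx hy => ?_
      · rw [B.sg_of_mem 1 ha, B.leibniz _ _ ha, mul_one, smul_mul_assoc]
      · simp only [add_mul, B.d_add, map_add, hx, hy]; abel
    simp [M.d_smul, M.sg_smul, tmul_smul, h, hl, φ.comm_d, add_assoc]

@[simp] theorem diff_tmul (m : M.carrier) (b : B.carrier) :
    diff φ M (tmul φ M m b) = tmul φ M (M.d m) b + tmul φ M (M.sg 1 m) (B.d b) :=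
  lift_tmul _ _ _ _

theorem diff_act {i : ℤ} {z : Carrier φ M} (hz : z ∈ grading φ M i) (b : B.carrier) :
    diff φ M (act φ M z b) = act φ M (diff φ M z) b + ksign i • act φ M z (B.d b) := by
  have := map_mem_of_tmul ((diff φ M).comp ((act φ M).flip b) - ((act φ M).flip b).comp (diff φ M)
    - ksign i • (act φ M).flip (B.d b)) ⊥ (n := i) (fun p q m c hpq hm hc => ?_) hz
  · rw [Submodule.mem_bot] at this
    simp only [LinearMap.sub_apply, LinearMap.comp_apply, LinearMap.flip_apply,
      LinearMap.smul_apply] at this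
    rw [sub_sub, sub_eq_zero] at this
    exact this
  · subst hpq
    simp [-zsmul_eq_mul, mul_comm (ksign p), B.leibniz _ _ hc, M.sg_of_mem 1 hm, ksign_add,
      smul_smul]

theorem diff_diff (z : Carrier φ M) : diff φ M (diff φ M z) = 0 := by
  refine induction z (fun i j m b hm hb => ?_) (by simp) fun x y hx hy => ?_
  · simp [M.d_sq, B.d_sq, M.sg_d]
  · rw [map_add, map_add, hx, hy, add_zero]

end BaseChange

open BaseChange

variable {A B : DGAlgebra R} (φ : DGAlgHom A B)

/-- The base change `M ⊗_A B` of a DG `A`-module along `φ : A → B`. -/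
abbrev DGModule.baseChange (M : DGModule R A) : DGModule R B where
  carrier := Carrier φ M
  grading := BaseChange.grading φ M
  indep := (BaseChange.isGrading φ M).indep
  spanning := (BaseChange.isGrading φ M).spanning
  smul z b := act φ M z b
  smul_add z := map_add _
  add_smul z z' b := LinearMap.map_add₂ _ _ _ _
  smul_rsmul r z b := map_smul _ _ _
  rsmul_smul r z b := LinearMap.map_smul₂ _ _ _ _
  smul_one z := by
    refine induction z (fun i j m b _ _ => by simp) (by simp) fun x y hx hy => ?_
    rw [LinearMap.map_add₂, hx, hy]
  smul_mul z b b' := by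
    refine induction z (fun i j m b _ _ => by simp [mul_assoc]) (by simp) fun x y hx hy => ?_
    simp only [LinearMap.map_add₂, hx, hy]
  smul_mem {i j z b} hz hb := by
    refine map_mem_of_tmul ((act φ M).flip b) (BaseChange.grading φ M (i + j))
      (fun p q m c hpq hm hc => ?_) hz
    rw [LinearMap.flip_apply, act_tmul, ← hpq, add_assoc]
    exact tmul_mem hm (B.mul_mem hc hb)
  d := diff φ M
  d_add := map_add _
  d_rsmul := map_smul _
  d_mem {i z} hz := by
    refine map_mem_of_tmul (diff φ M) (BaseChange.grading φ M (i - 1))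
      (fun p q m c hpq hm hc => ?_) hz
    rw [diff_tmul, ← hpq]
    refine add_mem ?_ ?_
    · convert tmul_mem (φ := φ) (M.d_mem hm) hc using 2; ring
    · convert tmul_mem (φ := φ) (M.sg_mem 1 hm) (B.d_mem hc) using 2; ring
  d_sq := diff_diff φ M
  leibniz z b hz := diff_act φ M hz b

theorem DGHom.ext_baseChange {M : DGModule R A} {W : DGModule R B} (f g : DGHom (M.baseChange φ) W)
    (h : ∀ m, f.toFun (tmul φ M m 1) = g.toFun (tmul φ M m 1)) (z : Carrier φ M) :
    f.toFun z = g.toFun z := by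
  refine induction z (fun i j m b _ _ => ?_) ?_ fun x y hx hy => ?_
  · have e : tmul φ M m b = (M.baseChange φ).smul (tmul φ M m 1) b := by
      change _ = act φ M _ _
      simp
    rw [e, f.map_smul, g.map_smul, h]
  · exact (map_zero (AddMonoidHom.mk' f.toFun f.map_add)).trans
      (map_zero (AddMonoidHom.mk' g.toFun g.map_add)).symm
  · exact (f.map_add x y).trans ((congrArg₂ _ hx hy).trans (g.map_add x y).symm)

/-- The universal property of `M ⊗_A B`. -/
def DGModule.baseChangeSpec (M : DGModule R A) : DGBaseChange φ M (M.baseChange φ) where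
  unit :=
    { toFun := fun m => tmul φ M m 1
      map_add := fun x y => by simp
      map_rsmul := fun r x => by simp
      map_mem := fun {i x} hx => by simpa using tmul_mem (φ := φ) hx B.one_mem
      map_smul := fun x a => by
        change _ = act φ M _ _
        simp [tmul_smul]
      comm_d := fun x => by
        change _ = diff φ M _
        simp [B.d_one] }
  univ W f := by
    let fL : M.carrier →ₗ[R] W.carrier := ⟨⟨f.toFun, f.map_add⟩, f.map_rsmul⟩
    let g : Carrier φ M →ₗ[R] W.carrier := lift (W.smulL.comp fL) fun m a b => by
      simp [fL, f.map_smul, W.smul_mul]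
    have hg : ∀ m b, g (tmul φ M m b) = W.smul (f.toFun m) b := fun m b => lift_tmul _ _ _ _
    let gh : DGHom (M.baseChange φ) W :=
      { toFun := g
        map_add := map_add g
        map_rsmul := map_smul g
        map_smul := fun z b => by
          change g (act φ M z b) = _
          refine induction z (fun i j m c _ _ => ?_) (by simp) fun x y hx hy => ?_
          · rw [act_tmul, hg, hg, W.smul_mul]
          · rw [LinearMap.map_add₂, map_add, map_add, W.add_smul, hx, hy]
        map_mem := fun {i z} hz => map_mem_of_tmul g (W.grading i)
          (fun p q m b hpq hm hb => by
            rw [hg, ← hpq]; exact W.smul_mem (f.map_mem hm) hb) hz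
        comm_d := fun z => by
          change g (diff φ M z) = _
          refine induction z (fun i j m c hm _ => ?_) (by simp) fun x y hx hy => ?_
          · rw [diff_tmul, map_add, hg, hg, hg, f.comm_d, W.leibniz _ _ (f.map_mem hm),
              M.sg_of_mem 1 hm, mul_one]
            congr 1
            rw [← W.zsmul_smul]
            congr 1
            exact map_zsmul fL _ _
          · rw [map_add, map_add, map_add, W.d_add, hx, hy] }
    have hgh : ∀ x, gh.toFun (tmul φ M x 1) = f.toFun x := fun x => by
      change g _ = _
      rw [hg, W.smul_one]
    exact ⟨gh, hgh, fun g' hg' => DGHom.ext_baseChange φ g' gh fun m =>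
      (hg' m).trans (hgh m).symm⟩

/-- Restriction of scalars along `φ : A → B`. -/
abbrev DGModule.restrict (N : DGModule R B) : DGModule R A where
  carrier := N.carrier
  grading := N.grading
  indep := N.indep
  spanning := N.spanning
  smul n a := N.smul n (φ.toFun a)
  smul_add n a b := by rw [φ.map_add, N.smul_add]
  add_smul n n' a := N.add_smul n n' _
  smul_rsmul r n a := by rw [φ.map_rsmul, N.smul_rsmul]
  rsmul_smul r n a := N.rsmul_smul r n _
  smul_one n := by rw [φ.map_one, N.smul_one]
  smul_mul n a b := by rw [N.smul_mul, φ.map_mul]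
  smul_mem hn ha := N.smul_mem hn (φ.map_mem ha)
  d := N.d
  d_add := N.d_add
  d_rsmul := N.d_rsmul
  d_mem := N.d_mem
  d_sq := N.d_sq
  leibniz n a hn := by rw [N.leibniz n _ hn, φ.comm_d]

/-- A DG algebra as a right DG module over itself. -/
abbrev DGAlgebra.selfModule (B : DGAlgebra R) : DGModule R B where
  carrier := B.carrier
  grading := B.grading
  indep := B.indep
  spanning := B.spanning
  smul x y := x * y
  smul_add := mul_add
  add_smul := add_mul
  smul_rsmul r x y := mul_smul_comm r x y
  rsmul_smul r x y := smul_mul_assoc r x y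
  smul_one := mul_one
  smul_mul := mul_assoc
  smul_mem := B.mul_mem
  d := B.d
  d_add := B.d_add
  d_rsmul := B.d_rsmul
  d_mem := B.d_mem
  d_sq := B.d_sq
  leibniz := B.leibniz

end

noncomputable section

variable {R : Type} [CommRing R] {A B : DGAlgebra R}

theorem DGAlgHom.map_zero (f : DGAlgHom A B) : f.toFun 0 = 0 :=
  _root_.map_zero (AddMonoidHom.mk' f.toFun f.map_add)

/-- A DG algebra homomorphism as a linear map. -/
def DGAlgHom.toLinear (f : DGAlgHom A B) : A.carrier →ₗ[R] B.carrier :=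
  ⟨⟨f.toFun, f.map_add⟩, f.map_rsmul⟩

@[simp] theorem DGAlgHom.toLinear_apply (f : DGAlgHom A B) (a : A.carrier) :
    f.toLinear a = f.toFun a := rfl

namespace Enveloping

open BaseChange

variable (φ : DGAlgHom A B)

/-- The tensor product `B ⊗_A B`. -/
abbrev Env : Type := Carrier φ (DGModule.restrict φ B.selfModule)

/-- The class of `x ⊗ y`. -/
abbrev tm : B.carrier →ₗ[R] B.carrier →ₗ[R] Env φ :=
  tmul φ (DGModule.restrict φ B.selfModule)

variable {φ}

theorem tm_mul (x : B.carrier) (a : A.carrier) (y : B.carrier) :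
    tm φ (x * φ.toFun a) y = tm φ x (φ.toFun a * y) :=
  tmul_smul (φ := φ) (M := DGModule.restrict φ B.selfModule) x a y

@[elab_as_elim]
theorem induction {p : Env φ → Prop} (z : Env φ)
    (tm : ∀ i j x y, x ∈ B.grading i → y ∈ B.grading j → p (tm φ x y)) (zero : p 0)
    (add : ∀ x y, p x → p y → p (x + y)) : p z :=
  BaseChange.induction z tm zero add

theorem hom_ext {W : Type} [AddCommGroup W] [Module R W] {f g : Env φ →ₗ[R] W}
    (h : ∀ i j x y, x ∈ B.grading i → y ∈ B.grading j → f (tm φ x y) = g (tm φ x y)) : f = g := by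
  ext z
  refine induction z h (by simp) fun x y hx hy => ?_
  rw [map_add, map_add, hx, hy]

variable (φ)

/-- The linear map out of `B ⊗_A B` induced by a balanced bilinear map. -/
def liftE {W : Type} [AddCommGroup W] [Module R W] (f : B.carrier →ₗ[R] B.carrier →ₗ[R] W)
    (hf : ∀ x a y, f (x * φ.toFun a) y = f x (φ.toFun a * y)) : Env φ →ₗ[R] W :=
  lift (φ := φ) (M := DGModule.restrict φ B.selfModule) f hf

@[simp] theorem liftE_tm {W : Type} [AddCommGroup W] [Module R W]
    (f : B.carrier →ₗ[R] B.carrier →ₗ[R] W)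
    (hf : ∀ x a y, f (x * φ.toFun a) y = f x (φ.toFun a * y)) (x y : B.carrier) :
    liftE φ f hf (tm φ x y) = f x y :=
  lift_tmul (φ := φ) (M := DGModule.restrict φ B.selfModule) f hf x y

/-- Left multiplication by `x ⊗ 1`. -/
def opL : B.carrier →ₗ[R] Env φ →ₗ[R] Env φ :=
  LinearMap.mk₂ R (fun x z => liftE φ ((tm φ).comp (LinearMap.mulLeft R x))
      (fun m a b => by
        rw [LinearMap.comp_apply, LinearMap.comp_apply, LinearMap.mulLeft_apply,
          LinearMap.mulLeft_apply, ← mul_assoc, tm_mul]) z)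
    (fun b b' z => by
      rw [← LinearMap.add_apply]; congr 1; refine hom_ext fun _ _ m c _ _ => ?_
      rw [LinearMap.add_apply, liftE_tm, liftE_tm, liftE_tm]; simp [add_mul])
    (fun r b z => by
      rw [← LinearMap.smul_apply]; congr 1; refine hom_ext fun _ _ m c _ _ => ?_
      rw [LinearMap.smul_apply, liftE_tm, liftE_tm]; simp)
    (fun b z z' => map_add _ _ _)
    (fun r b z => map_smul _ _ _)

theorem opL_tm (x x' y' : B.carrier) : opL φ x (tm φ x' y') = tm φ (x * x') y' := by
  rw [opL, LinearMap.mk₂_apply, liftE_tm]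
  rfl

/-- The trilinear map `(y, x', y') ↦ (-1)^{|y||x'|} x' ⊗ yy'`. -/
def opRTri : B.carrier →ₗ[R] B.carrier →ₗ[R] B.carrier →ₗ[R] Env φ :=
  B.isGrading.lift fun j =>
    { toFun := fun y => ((tm φ).comp (B.sg j)).compl₂ (LinearMap.mulLeft R y)
      map_add' := fun y y' => by ext; simp [add_mul]
      map_smul' := fun r y => by ext; simp }

theorem opRTri_of_mem {j : ℤ} {y : B.carrier} (hy : y ∈ B.grading j) (x' y' : B.carrier) :
    opRTri φ y x' y' = tm φ (B.sg j x') (y * y') := by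
  rw [opRTri, B.isGrading.lift_of_mem _ hy]
  rfl

theorem opRTri_of_mem_of_mem {i j : ℤ} {y x' : B.carrier} (hy : y ∈ B.grading j)
    (hx : x' ∈ B.grading i) (y' : B.carrier) :
    opRTri φ y x' y' = ksign (i * j) • tm φ x' (y * y') := by
  rw [opRTri_of_mem φ hy, B.sg_of_mem j hx, map_zsmul, LinearMap.smul_apply]

theorem opRTri_balanced (y x' : B.carrier) (a : A.carrier) (y' : B.carrier) :
    opRTri φ y (x' * φ.toFun a) y' = opRTri φ y x' (φ.toFun a * y') := by
  refine B.isGrading.induction y (fun j y hy => ?_) (by simp) fun u v hu hv => ?_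
  · refine B.isGrading.induction x' (fun i x' hx => ?_) (by simp) fun u v hu hv => ?_
    · refine A.isGrading.induction a (fun k a ha => ?_) (by simp [φ.map_zero]) fun u v hu hv => ?_
      · rw [opRTri_of_mem_of_mem φ hy (B.mul_mem hx (φ.map_mem ha)),
          opRTri_of_mem_of_mem φ hy hx, tm_mul, ← mul_assoc, ← mul_assoc,
          B.gcomm _ _ (φ.map_mem ha) hy, smul_mul_assoc, map_zsmul, smul_smul, ← ksign_add]
        congr 1
        exact ksign_congr ⟨k * j, by ring⟩
      · simp only [φ.map_add, mul_add, add_mul, map_add, LinearMap.add_apply, hu, hv]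
    · simp only [add_mul, map_add, LinearMap.add_apply, hu, hv]
  · simp only [map_add, LinearMap.add_apply, hu, hv]

/-- Left multiplication by `1 ⊗ y`. -/
def opR : B.carrier →ₗ[R] Env φ →ₗ[R] Env φ :=
  LinearMap.mk₂ R (fun y z => liftE φ (opRTri φ y) (opRTri_balanced φ y) z)
    (fun b b' z => by
      rw [← LinearMap.add_apply]; congr 1; refine hom_ext fun _ _ m c _ _ => ?_
      rw [LinearMap.add_apply, liftE_tm, liftE_tm, liftE_tm]; simp)
    (fun r b z => by
      rw [← LinearMap.smul_apply]; congr 1; refine hom_ext fun _ _ m c _ _ => ?_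
      rw [LinearMap.smul_apply, liftE_tm, liftE_tm]; simp)
    (fun b z z' => map_add _ _ _)
    (fun r b z => map_smul _ _ _)

theorem opR_tm {i j : ℤ} {y x' : B.carrier} (hy : y ∈ B.grading j)
    (hx : x' ∈ B.grading i) (y' : B.carrier) :
    opR φ y (tm φ x' y') = ksign (i * j) • tm φ x' (y * y') := by
  rw [opR, LinearMap.mk₂_apply, liftE_tm]
  exact opRTri_of_mem_of_mem φ hy hx _

/-- The multiplication of `B ⊗_A B`. -/
def mulL : Env φ →ₗ[R] Env φ →ₗ[R] Env φ :=
  liftE φ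
    (LinearMap.mk₂ R (fun x y => (opL φ x).comp (opR φ y))
      (fun x x' y => by ext; simp) (fun r x y => by ext; simp)
      (fun x y y' => by ext; simp) (fun r x y => by ext; simp))
    fun x a y => by
      refine B.isGrading.induction y (fun j y hy => ?_) (by simp) fun u v hu hv => ?_
      · refine A.isGrading.induction a (fun k a ha => ?_)
          (by simp [φ.map_zero]) fun u v hu hv => ?_
        · refine hom_ext fun i i' x' y' hx' hy' => ?_
          simp only [LinearMap.mk₂_apply, LinearMap.comp_apply]
          rw [opR_tm φ hy hx', opR_tm φ (B.mul_mem (φ.map_mem ha) hy) hx', map_zsmul, map_zsmul,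
            opL_tm, opL_tm, mul_assoc (φ.toFun a), ← tm_mul, mul_assoc, mul_assoc,
            B.gcomm _ _ (φ.map_mem ha) hx', mul_smul_comm, map_zsmul, LinearMap.smul_apply,
            smul_smul, ← ksign_add]
          congr 1
          exact ksign_congr ⟨0, by ring⟩
        · simp only [φ.map_add, mul_add, add_mul, map_add, LinearMap.add_apply] at hu hv ⊢
          rw [hu, hv]
      · simp only [mul_add, map_add] at hu hv ⊢
        rw [hu, hv]

theorem mulL_tm {i j : ℤ} (x : B.carrier) {y x' : B.carrier} (hy : y ∈ B.grading j)
    (hx : x' ∈ B.grading i) (y' : B.carrier) :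
    mulL φ (tm φ x y) (tm φ x' y') = ksign (i * j) • tm φ (x * x') (y * y') := by
  rw [mulL, liftE_tm, LinearMap.mk₂_apply, LinearMap.comp_apply, opR_tm φ hy hx, map_zsmul,
    opL_tm]

theorem mulL_assoc (u v w : Env φ) : mulL φ (mulL φ u v) w = mulL φ u (mulL φ v w) := by
  refine induction u (fun i j x y hx hy => ?_) (by simp) fun u v hu hv => ?_
  · refine induction v (fun i' j' x' y' hx' hy' => ?_) (by simp) fun u v hu hv => ?_
    · refine induction w (fun i'' j'' x'' y'' hx'' hy'' => ?_) (by simp) fun u v hu hv => ?_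
      · rw [mulL_tm φ x hy hx', mulL_tm φ x' hy' hx'', map_zsmul, map_zsmul, LinearMap.smul_apply,
          mulL_tm φ _ (B.mul_mem hy hy') hx'', mulL_tm φ x hy (B.mul_mem hx' hx''), smul_smul,
          smul_smul, ← ksign_add, ← ksign_add, mul_assoc, mul_assoc]
        congr 1
        exact ksign_congr ⟨0, by ring⟩
      · simp only [map_add, hu, hv]
    · simp only [map_add, LinearMap.add_apply, hu, hv]
  · simp only [map_add, LinearMap.add_apply, hu, hv]

theorem one_mulL (u : Env φ) : mulL φ (tm φ 1 1) u = u := by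
  refine induction u (fun i j x y hx hy => ?_) (by simp) fun u v hu hv => ?_
  · rw [mulL_tm φ 1 B.one_mem hx]; simp
  · rw [map_add, hu, hv]

theorem mulL_one (u : Env φ) : mulL φ u (tm φ 1 1) = u := by
  refine induction u (fun i j x y hx hy => ?_) (by simp) fun u v hu hv => ?_
  · rw [mulL_tm φ x hy B.one_mem]; simp
  · rw [LinearMap.map_add₂, hu, hv]

instance : Ring (Env φ) where
  __ := (inferInstance : AddCommGroup (Env φ))
  mul u v := mulL φ u v
  one := tm φ 1 1
  mul_assoc := mulL_assoc φ
  one_mul := one_mulL φ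
  mul_one := mulL_one φ
  zero_mul u := (mulL φ).map_zero₂ u
  mul_zero u := map_zero (mulL φ u)
  left_distrib u v w := map_add (mulL φ u) v w
  right_distrib u v w := (mulL φ).map_add₂ u v w

instance : Algebra R (Env φ) :=
  Algebra.ofModule (fun r u v => (mulL φ).map_smul₂ r u v) fun r u v => map_smul (mulL φ u) r v

theorem one_def : (1 : Env φ) = tm φ 1 1 := rfl

theorem tm_mul_tm {i j : ℤ} (x : B.carrier) {y x' : B.carrier} (hy : y ∈ B.grading j)
    (hx : x' ∈ B.grading i) (y' : B.carrier) :
    tm φ x y * tm φ x' y' = ksign (i * j) • tm φ (x * x') (y * y') :=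
  mulL_tm φ x hy hx _

/-- The grading of `B ⊗_A B`. -/
abbrev envGrading : ℤ → Submodule R (Env φ) :=
  BaseChange.grading φ (DGModule.restrict φ B.selfModule)

variable {φ}

theorem tm_mem {i j : ℤ} {x y : B.carrier} (hx : x ∈ B.grading i)
    (hy : y ∈ B.grading j) : tm φ x y ∈ envGrading φ (i + j) :=
  tmul_mem hx hy

@[elab_as_elim]
theorem span_induction {n : ℤ} {p : Env φ → Prop} {z : Env φ} (hz : z ∈ envGrading φ n)
    (tm : ∀ i j x y, i + j = n → x ∈ B.grading i → y ∈ B.grading j → p (tm φ x y)) (zero : p 0)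
    (add : ∀ u v, u ∈ envGrading φ n → v ∈ envGrading φ n → p u → p v → p (u + v))
    (smul : ∀ (r : R) u, p u → p (r • u)) : p z := by
  refine Submodule.span_induction (p := fun z _ => p z) ?_ zero add (fun r u _ hu => smul r u hu) hz
  rintro _ ⟨i, j, x, y, hij, hx, hy, rfl⟩
  exact tm i j x y hij hx hy

theorem one_mem : (1 : Env φ) ∈ envGrading φ 0 := by
  have h := tm_mem (φ := φ) B.one_mem B.one_mem
  rwa [add_zero] at h

theorem gcomm {n m : ℤ} {u v : Env φ} (hu : u ∈ envGrading φ n) (hv : v ∈ envGrading φ m) :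
    u * v = ksign (n * m) • (v * u) := by
  refine span_induction hu (fun i j x y hij hx hy => ?_) (by simp)
    (fun u v _ _ hu hv => by rw [add_mul, mul_add, hu, hv, smul_add])
    (fun r u hu => by rw [smul_mul_assoc, hu, mul_smul_comm, smul_comm])
  refine span_induction hv (fun i' j' x' y' hij' hx' hy' => ?_) (by simp)
    (fun u v _ _ hu hv => by rw [add_mul, mul_add, hu, hv, smul_add])
    (fun r u hu => by rw [smul_mul_assoc, mul_smul_comm, hu, smul_comm])
  rw [tm_mul_tm φ x hy hx', tm_mul_tm φ x' hy' hx, B.gcomm _ _ hx hx', B.gcomm _ _ hy hy',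
    map_zsmul, map_zsmul, LinearMap.smul_apply, smul_smul, smul_smul, smul_smul, ← ksign_add,
    ← ksign_add, ← ksign_add, ← hij, ← hij']
  congr 1
  exact ksign_congr ⟨-i * j', by ring⟩

theorem odd_sq {n : ℤ} (hn : Odd n) {u : Env φ} (hu : u ∈ envGrading φ n) : u * u = 0 := by
  refine span_induction hu (fun i j x y hij hx hy => ?_) (by simp)
    (fun u v hu hv hu' hv' => ?_) (fun r u hu => by rw [smul_mul_assoc, mul_smul_comm, hu]; simp)
  · rw [tm_mul_tm φ x hy hx]
    rcases Int.even_or_odd i with hi | hi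
    · have hj : Odd j := by rw [← hij] at hn; exact (Int.odd_add'.mp hn).mpr hi
      simp [B.odd_sq y hj hy]
    · simp [B.odd_sq x hi hx]
  · have hs : ksign (n * n) = -1 := by
      rw [ksign_congr (j := 1), ksign_one]
      exact (hn.mul hn).sub_odd odd_one
    rw [add_mul, mul_add, mul_add, hu', hv', gcomm hu hv, hs]
    simp

theorem mul_mem {n m : ℤ} {u v : Env φ} (hu : u ∈ envGrading φ n) (hv : v ∈ envGrading φ m) :
    u * v ∈ envGrading φ (n + m) := by
  refine span_induction hu (fun i j x y hij hx hy => ?_) (by simp)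
    (fun u v _ _ hu hv => by rw [add_mul]; exact add_mem hu hv)
    (fun r u hu => by rw [smul_mul_assoc]; exact Submodule.smul_mem _ r hu)
  refine span_induction hv (fun i' j' x' y' hij' hx' hy' => ?_) (by simp)
    (fun u v _ _ hu hv => by rw [mul_add]; exact add_mem hu hv)
    (fun r u hu => by rw [mul_smul_comm]; exact Submodule.smul_mem _ r hu)
  rw [tm_mul_tm φ x hy hx']
  refine zsmul_mem ?_ _
  convert tm_mem (B.mul_mem hx hx') (B.mul_mem hy hy') using 2
  rw [← hij, ← hij']; ring

variable (φ)

/-- The differential of `B ⊗_A B`. -/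
abbrev envD : Env φ →ₗ[R] Env φ := diff φ (DGModule.restrict φ B.selfModule)

variable {φ}

theorem envD_tm {i : ℤ} {x : B.carrier} (hx : x ∈ B.grading i) (y : B.carrier) :
    envD φ (tm φ x y) = tm φ (B.d x) y + ksign i • tm φ x (B.d y) := by
  rw [envD, diff_tmul, DGModule.sg_of_mem (DGModule.restrict φ B.selfModule) 1 hx, mul_one,
    map_zsmul, LinearMap.smul_apply]

theorem leibniz {n : ℤ} {u : Env φ} (hu : u ∈ envGrading φ n) (v : Env φ) :
    envD φ (u * v) = envD φ u * v + ksign n • (u * envD φ v) := by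
  refine span_induction hu (fun i j x y hij hx hy => ?_) (by simp)
    (fun u v _ _ hu hv => by
      rw [add_mul, map_add, hu, hv, map_add, add_mul, add_mul, smul_add]; abel)
    (fun r u hu => by
      rw [smul_mul_assoc, map_smul, hu, map_smul, smul_mul_assoc, smul_mul_assoc, smul_add,
        smul_comm r])
  refine induction v (fun i' j' x' y' hx' hy' => ?_) (by simp) fun u v hu hv => ?_
  · rw [tm_mul_tm φ x hy hx', map_zsmul, envD_tm (B.mul_mem hx hx'), envD_tm hx, envD_tm hx',
      add_mul, mul_add, tm_mul_tm φ _ hy hx', smul_mul_assoc, tm_mul_tm φ _ (B.d_mem hy) hx',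
      mul_smul_comm, tm_mul_tm φ _ hy (B.d_mem hx'), tm_mul_tm φ _ hy hx', B.leibniz _ _ hx,
      B.leibniz _ _ hy, ← hij]
    simp only [map_add, map_zsmul, LinearMap.add_apply, LinearMap.smul_apply, smul_add, smul_smul,
      ← ksign_add]
    rw [ksign_congr (i := i' * j + (i + i')) (j := i + i' * (j - 1)) ⟨i', by ring⟩,
      ksign_congr (i := i' * j + i) (j := i + j + (i' - 1) * j) ⟨0, by ring⟩,
      ksign_congr (i := i' * j + (i + i' + j)) (j := i + j + (i' + i' * j)) ⟨0, by ring⟩]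
    abel
  · rw [mul_add, map_add, hu, hv, map_add, mul_add, mul_add, smul_add]; abel

end Enveloping

open Enveloping in
/-- The DG algebra `B ⊗_A B`. -/
abbrev DGAlgHom.env (φ : DGAlgHom A B) : DGAlgebra R where
  carrier := Env φ
  grading := envGrading φ
  indep := (BaseChange.isGrading φ _).indep
  spanning := (BaseChange.isGrading φ _).spanning
  nonneg n hn := by
    rw [eq_bot_iff]
    intro u hu
    refine span_induction hu (fun i j x y hij hx hy => ?_) (zero_mem _)
      (fun u v _ _ hu hv => add_mem hu hv) (fun r u hu => Submodule.smul_mem _ r hu)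
    rw [Submodule.mem_bot]
    rcases lt_or_ge i 0 with hi | hi
    · rw [B.nonneg i hi, Submodule.mem_bot] at hx
      simp [hx]
    · rw [B.nonneg j (by linarith), Submodule.mem_bot] at hy
      simp [hy]
  one_mem := Enveloping.one_mem
  mul_mem hu hv := Enveloping.mul_mem hu hv
  gcomm _ _ hu hv := Enveloping.gcomm hu hv
  odd_sq _ hn hu := Enveloping.odd_sq hn hu
  d := envD φ
  d_add := _root_.map_add _
  d_rsmul := map_smul _
  d_mem := ((DGModule.restrict φ B.selfModule).baseChange φ).d_mem
  d_sq := ((DGModule.restrict φ B.selfModule).baseChange φ).d_sq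
  leibniz _ v hu := Enveloping.leibniz hu v

end

noncomputable section

variable {R : Type} [CommRing R] {A B E : DGAlgebra R}

namespace Enveloping

variable {φ : DGAlgHom A B}

theorem tm_one_mul (x x' y' : B.carrier) : tm φ x 1 * tm φ x' y' = tm φ (x * x') y' := by
  refine B.isGrading.induction x' (fun i x' hx' => ?_) (by simp) fun u v hu hv => ?_
  · rw [tm_mul_tm φ x B.one_mem hx', one_mul, mul_zero, ksign_zero, one_smul]
  · rw [LinearMap.map_add₂, mul_add, hu, hv, mul_add, LinearMap.map_add₂]

theorem tm_mul_one (x y y' : B.carrier) : tm φ x y * tm φ 1 y' = tm φ x (y * y') := by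
  refine B.isGrading.induction y (fun i y hy => ?_) (by simp) fun u v hu hv => ?_
  · rw [tm_mul_tm φ x hy B.one_mem, mul_one, zero_mul, ksign_zero, one_smul]
  · rw [map_add, add_mul, hu, hv, add_mul, map_add]

variable (φ)

/-- The map `b ↦ b ⊗ 1`. -/
def inl : DGAlgHom B φ.env where
  toFun b := tm φ b 1
  map_one := rfl
  map_mul x y := (tm_one_mul x y 1).symm
  map_add x y := LinearMap.map_add₂ _ _ _ _
  map_rsmul r x := LinearMap.map_smul₂ _ _ _ _
  map_mem hx := by simpa using tm_mem hx B.one_mem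
  comm_d x := by
    change _ = envD φ (tm φ x 1)
    rw [envD, BaseChange.diff_tmul, B.d_one, map_zero, add_zero]

/-- The map `b ↦ 1 ⊗ b`. -/
def inr : DGAlgHom B φ.env where
  toFun b := tm φ 1 b
  map_one := rfl
  map_mul x y := (tm_mul_one 1 x y).symm
  map_add x y := map_add _ _ _
  map_rsmul r x := map_smul _ _ _
  map_mem hx := by simpa using tm_mem B.one_mem hx
  comm_d x := by
    refine Eq.symm ((envD_tm B.one_mem x).trans ?_)
    rw [B.d_one, ksign_zero, one_smul, map_zero, LinearMap.zero_apply, zero_add]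

variable {φ}

theorem inl_eq_inr (a : A.carrier) :
    (inl φ).toFun (φ.toFun a) = (inr φ).toFun (φ.toFun a) := by
  have h := tm_mul (φ := φ) 1 a 1
  rwa [one_mul, mul_one] at h

end Enveloping

/-- Composition of DG algebra homomorphisms. -/
def DGAlgHom.comp {C : DGAlgebra R} (g : DGAlgHom B C) (f : DGAlgHom A B) : DGAlgHom A C where
  toFun x := g.toFun (f.toFun x)
  map_one := by rw [f.map_one, g.map_one]
  map_mul x y := by rw [f.map_mul, g.map_mul]
  map_add x y := by rw [f.map_add, g.map_add]
  map_rsmul r x := by rw [f.map_rsmul, g.map_rsmul]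
  map_mem hx := g.map_mem (f.map_mem hx)
  comm_d x := by rw [f.comm_d, g.comm_d]

/-- The identity DG algebra homomorphism. -/
def DGAlgHom.id (A : DGAlgebra R) : DGAlgHom A A where
  toFun x := x
  map_one := rfl
  map_mul _ _ := rfl
  map_add _ _ := rfl
  map_rsmul _ _ := rfl
  map_mem hx := hx
  comm_d _ := rfl

namespace EnvelopingAlg

open Enveloping

variable {φ : DGAlgHom A B} (he : EnvelopingAlg φ E)

/-- The linear map `B ⊗_A B → E`, `x ⊗ y ↦ l x * r y`. -/
def ofEnvL : Env φ →ₗ[R] E.carrier :=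
  liftE φ (LinearMap.mk₂ R (fun x y => he.l.toFun x * he.r.toFun y)
    (fun x x' y => by rw [he.l.map_add, add_mul])
    (fun r x y => by rw [he.l.map_rsmul, smul_mul_assoc])
    (fun x y y' => by rw [he.r.map_add, mul_add])
    (fun r x y => by rw [he.r.map_rsmul, mul_smul_comm]))
    fun x a y => by
      simp only [LinearMap.mk₂_apply, he.l.map_mul, he.r.map_mul, he.compat, mul_assoc]

@[simp] theorem ofEnvL_tm (x y : B.carrier) :
    he.ofEnvL (tm φ x y) = he.l.toFun x * he.r.toFun y := by
  rw [ofEnvL, liftE_tm, LinearMap.mk₂_apply]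

/-- The DG algebra homomorphism `B ⊗_A B → E`, `x ⊗ y ↦ l x * r y`. -/
def ofEnv : DGAlgHom φ.env E where
  toFun := he.ofEnvL
  map_one := by
    rw [one_def, ofEnvL_tm, he.l.map_one, he.r.map_one, mul_one]
  map_mul u v := by
    refine Enveloping.induction u (fun i j x y hx hy => ?_) (by simp) fun u v hu hv => ?_
    · refine Enveloping.induction v (fun i' j' x' y' hx' hy' => ?_) (by simp) fun u v hu hv => ?_
      · rw [tm_mul_tm φ x hy hx', map_zsmul, ofEnvL_tm, ofEnvL_tm, ofEnvL_tm, he.l.map_mul,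
          he.r.map_mul, mul_assoc, mul_assoc, ← mul_assoc (he.r.toFun y),
          E.gcomm _ _ (he.r.map_mem hy) (he.l.map_mem hx'), smul_mul_assoc, mul_smul_comm,
          mul_assoc, mul_comm i']
      · rw [mul_add, map_add, map_add, hu, hv, mul_add]
    · rw [add_mul, map_add, map_add, hu, hv, add_mul]
  map_add := map_add _
  map_rsmul := map_smul _
  map_mem {n u} hu := by
    refine span_induction hu (fun i j x y hij hx hy => ?_) (by simp)
      (fun u v _ _ hu hv => by rw [map_add]; exact add_mem hu hv)
      (fun r u hu => by rw [map_smul]; exact Submodule.smul_mem _ r hu)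
    rw [ofEnvL_tm, ← hij]
    exact E.mul_mem (he.l.map_mem hx) (he.r.map_mem hy)
  comm_d u := by
    change he.ofEnvL (envD φ u) = E.dL (he.ofEnvL u)
    refine Enveloping.induction u (fun i j x y hx hy => ?_) (by simp) fun u v hu hv => ?_
    · rw [envD_tm hx, map_add, map_zsmul, ofEnvL_tm, ofEnvL_tm, ofEnvL_tm, DGAlgebra.dL_apply,
        E.leibniz _ _ (he.l.map_mem hx), he.l.comm_d, he.r.comm_d]
    · rw [map_add, map_add, map_add, map_add, hu, hv]

/-- The DG algebra homomorphism `E → B ⊗_A B`. -/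
def toEnv : DGAlgHom E φ.env := (he.univ φ.env (inl φ) (inr φ) inl_eq_inr).choose

theorem toEnv_l (b : B.carrier) : he.toEnv.toFun (he.l.toFun b) = tm φ b 1 :=
  (he.univ φ.env (inl φ) (inr φ) inl_eq_inr).choose_spec.1 b

theorem toEnv_r (b : B.carrier) : he.toEnv.toFun (he.r.toFun b) = tm φ 1 b :=
  (he.univ φ.env (inl φ) (inr φ) inl_eq_inr).choose_spec.2.1 b

theorem toEnv_mul (x y : B.carrier) :
    he.toEnv.toFun (he.l.toFun x * he.r.toFun y) = tm φ x y := by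
  rw [he.toEnv.map_mul, toEnv_l, toEnv_r]
  exact (tm_one_mul x 1 y).trans (by rw [mul_one])

theorem ofEnv_toEnv (z : E.carrier) : he.ofEnvL (he.toEnv.toFun z) = z := by
  obtain ⟨h, -, -, hh⟩ := he.univ E he.l he.r he.compat
  refine (hh (he.ofEnv.comp he.toEnv) ⟨fun b => ?_, fun b => ?_⟩ z).trans
    (hh (DGAlgHom.id E) ⟨fun _ => rfl, fun _ => rfl⟩ z).symm
  · change he.ofEnvL (he.toEnv.toFun _) = _
    rw [toEnv_l, ofEnvL_tm, he.r.map_one, mul_one]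
  · change he.ofEnvL (he.toEnv.toFun _) = _
    rw [toEnv_r, ofEnvL_tm, he.l.map_one, one_mul]

include he in
@[elab_as_elim]
theorem induction {p : E.carrier → Prop} (z : E.carrier)
    (mul : ∀ i j x y, x ∈ B.grading i → y ∈ B.grading j → p (he.l.toFun x * he.r.toFun y))
    (zero : p 0) (add : ∀ x y, p x → p y → p (x + y)) : p z := by
  rw [← he.ofEnv_toEnv z]
  refine Enveloping.induction (p := fun u => p (he.ofEnvL u)) (he.toEnv.toFun z)
    (fun i j x y hx hy => ?_) (by rwa [map_zero]) fun x y hx hy => ?_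
  · rw [ofEnvL_tm]; exact mul i j x y hx hy
  · rw [map_add]; exact add _ _ hx hy

end EnvelopingAlg
end

noncomputable section

variable {R : Type} [CommRing R] {A B E : DGAlgebra R}

/-- The DG `B`-module `N|_A ⊗_A B`. -/
def DGModule.induced (φ : DGAlgHom A B) (N : DGModule R B) : DGModule R B :=
  (DGModule.restrict φ N).baseChange φ

namespace Induced

variable (φ : DGAlgHom A B) (N : DGModule R B)

/-- The class of `n ⊗ b` in `N|_A ⊗_A B`. -/
def nt : N.carrier →ₗ[R] B.carrier →ₗ[R] (N.induced φ).carrier :=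
  BaseChange.tmul φ (DGModule.restrict φ N)

variable {φ N}

theorem nt_smul (n : N.carrier) (a : A.carrier) (b : B.carrier) :
    nt φ N (N.smul n (φ.toFun a)) b = nt φ N n (φ.toFun a * b) :=
  BaseChange.tmul_smul (φ := φ) (M := DGModule.restrict φ N) n a b

theorem smul_nt (n : N.carrier) (b b' : B.carrier) :
    (N.induced φ).smul (nt φ N n b) b' = nt φ N n (b * b') :=
  BaseChange.act_tmul (φ := φ) (M := DGModule.restrict φ N) n b b'

theorem d_nt (n : N.carrier) (b : B.carrier) :
    (N.induced φ).d (nt φ N n b) = nt φ N (N.d n) b + nt φ N (N.sg 1 n) (B.d b) :=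
  BaseChange.diff_tmul (φ := φ) (M := DGModule.restrict φ N) n b

theorem nt_mem {i j : ℤ} {n : N.carrier} {b : B.carrier} (hn : n ∈ N.grading i)
    (hb : b ∈ B.grading j) : nt φ N n b ∈ (N.induced φ).grading (i + j) :=
  BaseChange.tmul_mem (M := DGModule.restrict φ N) hn hb

@[elab_as_elim]
theorem induction {p : (N.induced φ).carrier → Prop} (z : (N.induced φ).carrier)
    (nt : ∀ i j n b, n ∈ N.grading i → b ∈ B.grading j → p (nt φ N n b)) (zero : p 0)
    (add : ∀ x y, p x → p y → p (x + y)) : p z :=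
  BaseChange.induction (M := DGModule.restrict φ N) z nt zero add

variable (φ)

/-- The linear map out of `N|_A ⊗_A B` induced by a balanced bilinear map. -/
def lift {W : Type} [AddCommGroup W] [Module R W] (f : N.carrier →ₗ[R] B.carrier →ₗ[R] W)
    (hf : ∀ n a b, f (N.smul n (φ.toFun a)) b = f n (φ.toFun a * b)) :
    (N.induced φ).carrier →ₗ[R] W :=
  BaseChange.lift (φ := φ) (M := DGModule.restrict φ N) f hf

@[simp] theorem lift_nt {W : Type} [AddCommGroup W] [Module R W]
    (f : N.carrier →ₗ[R] B.carrier →ₗ[R] W)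
    (hf : ∀ n a b, f (N.smul n (φ.toFun a)) b = f n (φ.toFun a * b))
    (n : N.carrier) (b : B.carrier) : lift φ f hf (nt φ N n b) = f n b :=
  BaseChange.lift_tmul (φ := φ) (M := DGModule.restrict φ N) f hf n b

theorem map_mem_of_nt {W : Type} [AddCommGroup W] [Module R W]
    (f : (N.induced φ).carrier →ₗ[R] W) (S : Submodule R W) {k : ℤ}
    (h : ∀ i j n b, i + j = k → n ∈ N.grading i → b ∈ B.grading j → f (nt φ N n b) ∈ S)
    {z : (N.induced φ).carrier} (hz : z ∈ (N.induced φ).grading k) : f z ∈ S :=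
  BaseChange.map_mem_of_tmul (φ := φ) (M := DGModule.restrict φ N) f S h hz

variable (N)

/-- The multiplication map `N|_A ⊗_A B → N`, `n ⊗ b ↦ nb`, as a linear map. -/
def mulMapL : (N.induced φ).carrier →ₗ[R] N.carrier :=
  lift φ N.smulL fun n a b => by rw [N.smulL_apply, N.smulL_apply, N.smul_mul]

@[simp] theorem mulMapL_nt (n : N.carrier) (b : B.carrier) :
    mulMapL φ N (nt φ N n b) = N.smul n b := by
  rw [mulMapL, lift_nt, N.smulL_apply]

/-- The multiplication map `N|_A ⊗_A B → N`, `n ⊗ b ↦ nb`. -/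
def mulMap : DGHom (N.induced φ) N where
  toFun := mulMapL φ N
  map_add := map_add _
  map_rsmul := map_smul _
  map_smul z b := by
    refine induction z (fun i j n c _ _ => ?_) (by simp) fun x y hx hy => ?_
    · rw [smul_nt, mulMapL_nt, mulMapL_nt, N.smul_mul]
    · rw [DGModule.add_smul, map_add, map_add, hx, hy, DGModule.add_smul]
  map_mem {k z} hz := by
    refine map_mem_of_nt φ (mulMapL φ N) (N.grading k) (fun i j n b hij hn hb => ?_) hz
    rw [mulMapL_nt, ← hij]
    exact N.smul_mem hn hb
  comm_d z := by
    refine induction z (fun i j n c _ _ => ?_) (by simp) fun x y hx hy => ?_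
    · rw [d_nt, map_add, mulMapL_nt, mulMapL_nt, mulMapL_nt, N.d_smul]
    · rw [DGModule.d_add, map_add, map_add, hx, hy, DGModule.d_add]

@[simp] theorem mulMap_nt (n : N.carrier) (b : B.carrier) :
    (mulMap φ N).toFun (nt φ N n b) = N.smul n b := mulMapL_nt φ N n b

end Induced

namespace EnvelopingAlg

open Enveloping Induced

variable {φ : DGAlgHom A B} (he : EnvelopingAlg φ E) (N : DGModule R B)

/-- The right action `n ⋅ (x ⊗ y) = nx ⊗ y` of `B ⊗_A B`, with values in `N|_A ⊗_A B`. -/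
def envPair (φ : DGAlgHom A B) (N : DGModule R B) :
    N.carrier →ₗ[R] Env φ →ₗ[R] (N.induced φ).carrier :=
  LinearMap.mk₂ R (fun n z => liftE φ ((nt φ N).comp (N.smulL n)) (fun x a y => by
      rw [LinearMap.comp_apply, LinearMap.comp_apply, N.smulL_apply, N.smulL_apply, ← N.smul_mul,
        nt_smul]) z)
    (fun n n' z => by
      rw [← LinearMap.add_apply]; congr 1; refine hom_ext fun _ _ m c _ _ => ?_
      rw [LinearMap.add_apply, liftE_tm, liftE_tm, liftE_tm]; simp)
    (fun r n z => by
      rw [← LinearMap.smul_apply]; congr 1; refine hom_ext fun _ _ m c _ _ => ?_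
      rw [LinearMap.smul_apply, liftE_tm, liftE_tm]; simp)
    (fun n z z' => map_add _ _ _)
    (fun r n z => map_smul _ _ _)

theorem envPair_tm (n : N.carrier) (x y : B.carrier) :
    envPair φ N n (tm φ x y) = nt φ N (N.smul n x) y := by
  rw [envPair, LinearMap.mk₂_apply, liftE_tm]
  rfl

/-- The pairing `N ⊗ E → N|_A ⊗_A B`, `(n, l x * r y) ↦ nx ⊗ y`. -/
def pair : N.carrier →ₗ[R] E.carrier →ₗ[R] (N.induced φ).carrier :=
  (envPair φ N).compl₂ he.toEnv.toLinear

@[simp] theorem pair_mul (n : N.carrier) (x y : B.carrier) :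
    he.pair N n (he.l.toFun x * he.r.toFun y) = nt φ N (N.smul n x) y := by
  rw [pair, LinearMap.compl₂_apply, DGAlgHom.toLinear_apply, toEnv_mul, envPair_tm]

theorem pair_smul (n : N.carrier) (b : B.carrier) (z : E.carrier) :
    he.pair N (N.smul n b) z = he.pair N n (he.l.toFun b * z) := by
  refine he.induction z (fun i j x y _ _ => ?_) (by simp) fun x y hx hy => ?_
  · rw [pair_mul, ← mul_assoc, ← he.l.map_mul, pair_mul, N.smul_mul]
  · rw [mul_add, map_add, map_add, hx, hy]

theorem pair_mul_r (n : N.carrier) (b : B.carrier) (z : E.carrier) :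
    he.pair N n (z * he.r.toFun b) = (N.induced φ).smul (he.pair N n z) b := by
  refine he.induction z (fun i j x y _ _ => ?_) (by simp) fun x y hx hy => ?_
  · rw [pair_mul, mul_assoc, ← he.r.map_mul, pair_mul, smul_nt]
  · rw [add_mul, map_add, map_add, hx, hy, DGModule.add_smul]

theorem pair_mem {i j : ℤ} {n : N.carrier} {z : E.carrier} (hn : n ∈ N.grading i)
    (hz : z ∈ E.grading j) : he.pair N n z ∈ (N.induced φ).grading (i + j) := by
  have h : he.toEnv.toFun z ∈ envGrading φ j := he.toEnv.map_mem hz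
  rw [pair, LinearMap.compl₂_apply, DGAlgHom.toLinear_apply]
  refine span_induction h (fun k l x y hkl hx hy => ?_) (by simp)
    (fun u v _ _ hu hv => by rw [map_add]; exact add_mem hu hv)
    (fun r u hu => by rw [map_smul]; exact Submodule.smul_mem _ r hu)
  rw [envPair_tm, ← hkl, ← add_assoc]
  exact nt_mem (N.smul_mem hn hx) hy

theorem d_pair (n : N.carrier) (z : E.carrier) :
    (N.induced φ).d (he.pair N n z) =
      he.pair N (N.d n) z + he.pair N (N.sg 1 n) (E.d z) := by
  refine he.induction z (fun i j x y hx hy => ?_) (by simp) fun x y hx hy => ?_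
  · rw [E.leibniz _ _ (he.l.map_mem hx), map_add, map_zsmul, pair_mul, pair_mul,
      ← he.l.comm_d, ← he.r.comm_d, pair_mul, pair_mul, d_nt, N.d_smul, N.sg_smul,
      B.sg_of_mem 1 hx, mul_one, N.smul_zsmul, map_zsmul, map_add]
    simp only [LinearMap.add_apply, LinearMap.smul_apply]
    abel
  · simp only [map_add, DGModule.d_add, E.d_add, hx, hy]
    abel

end EnvelopingAlg
end

noncomputable section

variable {R : Type} [CommRing R] {A : DGAlgebra R}

namespace GradedHom

variable {M N : DGModule R A} {k : ℤ}

/-- A graded homomorphism as a linear map. -/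
def toLinear (f : GradedHom M N k) : M.carrier →ₗ[R] N.carrier :=
  ⟨⟨f.toFun, f.map_add⟩, f.map_rsmul⟩

@[simp] theorem toLinear_apply (f : GradedHom M N k) (m : M.carrier) :
    f.toLinear m = f.toFun m := rfl

end GradedHom

namespace SemifreeBasisOn

variable {N : DGModule R A} {κ : Type} {e : κ → N.carrier} (b : SemifreeBasisOn N e)

/-- The coordinates with respect to a semifree basis. -/
def repr : N.carrier ≃ₗ[R] (κ →₀ A.carrier) :=
  (LinearEquiv.ofBijective (Finsupp.lsum R fun k => N.smulL (e k)) b.basis).symm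

theorem repr_symm_apply (c : κ →₀ A.carrier) :
    b.repr.symm c = c.sum fun k a => N.smul (e k) a := rfl

theorem sum_repr (n : N.carrier) : ((b.repr n).sum fun k a => N.smul (e k) a) = n := by
  rw [← repr_symm_apply, LinearEquiv.symm_apply_apply]

theorem repr_basis_smul (k : κ) (a : A.carrier) :
    b.repr (N.smul (e k) a) = Finsupp.single k a := by
  rw [← LinearEquiv.eq_symm_apply, repr_symm_apply,
    Finsupp.sum_single_index (h := fun k a => N.smul (e k) a) (N.smul_zero _)]

include b in
@[elab_as_elim]
theorem induction {p : N.carrier → Prop} (n : N.carrier)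
    (basis : ∀ k i a, a ∈ A.grading i → p (N.smul (e k) a)) (zero : p 0)
    (add : ∀ x y, p x → p y → p (x + y)) : p n := by
  rw [← b.sum_repr n]
  refine Finset.sum_induction _ p add zero fun k _ => ?_
  refine A.isGrading.induction (b.repr n k) (fun i a ha => basis k i a ha) (by simpa) ?_
  intro x y hx hy
  beta_reduce
  rw [N.smul_add]
  exact add _ _ hx hy

/-- The `k`-th coordinate function. -/
def coord (k : κ) : N.carrier →ₗ[R] A.carrier := (Finsupp.lapply k).comp b.repr.toLinearMap

theorem coord_apply (k : κ) (n : N.carrier) : b.coord k n = b.repr n k := rfl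

theorem repr_smul (n : N.carrier) (a : A.carrier) :
    b.repr (N.smul n a) = Finsupp.mapRange.linearMap (LinearMap.mulRight R a) (b.repr n) := by
  refine b.induction n (fun k i a' _ => ?_) (by simp) fun x y hx hy => ?_
  · rw [N.smul_mul, repr_basis_smul, repr_basis_smul, Finsupp.mapRange.linearMap_apply,
      Finsupp.mapRange_single, LinearMap.mulRight_apply]
  · rw [N.add_smul, map_add, map_add, hx, hy, map_add]

theorem coord_smul (k : κ) (n : N.carrier) (a : A.carrier) :
    b.coord k (N.smul n a) = b.coord k n * a := by
  rw [coord_apply, repr_smul]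
  rfl

theorem coord_basis_smul_self (k : κ) (a : A.carrier) : b.coord k (N.smul (e k) a) = a := by
  rw [coord_apply, repr_basis_smul, Finsupp.single_eq_same]

theorem coord_basis_smul_of_ne {j k : κ} (h : j ≠ k) (a : A.carrier) :
    b.coord j (N.smul (e k) a) = 0 := by
  rw [coord_apply, repr_basis_smul, Finsupp.single_eq_of_ne h]

theorem coord_basis_self (k : κ) : b.coord k (e k) = 1 := by
  rw [← b.coord_basis_smul_self k 1, N.smul_one]

theorem coord_basis_of_ne {j k : κ} (h : j ≠ k) : b.coord j (e k) = 0 := by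
  rw [← b.coord_basis_smul_of_ne h 1, N.smul_one]

theorem eq_zero_of_coord {n : N.carrier} (h : ∀ k, b.coord k n = 0) : n = 0 := by
  rw [← b.repr.map_eq_zero_iff]
  ext k
  exact h k

theorem coord_proj (k : κ) (i : ℤ) (n : N.carrier) :
    b.coord k (N.isGrading.proj i n) = A.isGrading.proj (i - b.deg k) (b.coord k n) := by
  refine b.induction n (fun j l a ha => ?_) (by simp) fun x y hx hy => ?_
  · have hm := N.smul_mem (b.homog j) ha
    rcases eq_or_ne k j with rfl | hk
    · rw [coord_basis_smul_self]
      rcases eq_or_ne (b.deg k + l) i with rfl | h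
      · rw [N.isGrading.proj_of_mem hm, coord_basis_smul_self, add_sub_cancel_left,
          A.isGrading.proj_of_mem ha]
      · rw [N.isGrading.proj_of_mem_ne h hm, map_zero, A.isGrading.proj_of_mem_ne _ ha]
        contrapose! h
        linarith
    · rw [b.coord_basis_smul_of_ne hk, map_zero]
      rcases eq_or_ne (b.deg j + l) i with rfl | h
      · rw [N.isGrading.proj_of_mem hm, b.coord_basis_smul_of_ne hk]
      · rw [N.isGrading.proj_of_mem_ne h hm, map_zero]
  · simp only [map_add, hx, hy]

theorem coord_mem {i : ℤ} {n : N.carrier} (hn : n ∈ N.grading i) (k : κ) :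
    b.coord k n ∈ A.grading (i - b.deg k) := by
  rw [← N.isGrading.proj_of_mem hn, coord_proj]
  exact A.isGrading.proj_mem _ _

theorem coord_d {j : κ} {n : N.carrier} (h : ∀ i, b.lt j i → b.coord i n = 0) :
    b.coord j (N.d n) = ksign (b.deg j) • A.d (b.coord j n) := by
  classical
  have key : ∀ k, b.coord j (N.d (N.smul (e k) (b.repr n k))) =
      if k = j then ksign (b.deg j) • A.d (b.coord j n) else 0 := by
    intro k
    by_cases hk : b.lt j k
    · have h0 : b.repr n k = 0 := h k hk
      have hkj : k ≠ j := by
        rintro rfl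
        exact b.wf.irrefl.irrefl _ hk
      rw [h0, N.smul_zero, N.d_zero, map_zero, if_neg hkj]
    · have hd : b.coord j (N.d (e k)) = 0 := by
        obtain ⟨c, hc, hd⟩ := b.d_lower k
        rw [hd, ← b.repr_symm_apply, coord_apply, LinearEquiv.apply_symm_apply]
        by_contra hne
        exact hk (hc j (Finsupp.mem_support_iff.mpr hne))
      rw [N.leibniz _ _ (b.homog k), map_add, map_zsmul, coord_smul, hd, zero_mul, zero_add]
      split_ifs with hkj
      · subst hkj
        rw [coord_basis_smul_self]; rfl
      · rw [b.coord_basis_smul_of_ne (Ne.symm hkj), smul_zero]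
  have hn : b.coord j (N.d n) = (b.repr n).sum fun k a => b.coord j (N.d (N.smul (e k) a)) := by
    conv_lhs => rw [← b.sum_repr n]
    exact map_finsuppSum ((b.coord j).comp N.dL) _ _
  rw [hn, Finsupp.sum, Finset.sum_congr rfl fun k _ => key k, Finset.sum_ite_eq']
  split_ifs with hj
  · rfl
  · rw [coord_apply, Finsupp.notMem_support_iff.mp hj, A.d_zero, smul_zero]

/-- The linear map with prescribed values on a semifree basis. -/
def constrL {W : DGModule R A} (t : κ → W.carrier) : N.carrier →ₗ[R] W.carrier :=
  (Finsupp.lsum R fun k => W.smulL (t k)).comp b.repr.toLinearMap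

theorem constrL_basis_smul {W : DGModule R A} (t : κ → W.carrier) (k : κ) (a : A.carrier) :
    b.constrL t (N.smul (e k) a) = W.smul (t k) a := by
  rw [constrL, LinearMap.comp_apply, LinearEquiv.coe_coe, repr_basis_smul, Finsupp.lsum_single,
    W.smulL_apply]

/-- The graded homomorphism with prescribed homogeneous values on a semifree basis. -/
def constr {W : DGModule R A} (m : ℤ) (t : κ → W.carrier)
    (ht : ∀ k, t k ∈ W.grading (b.deg k + m)) : GradedHom N W m where
  toFun := b.constrL t
  map_add := map_add _
  map_rsmul := map_smul _
  map_smul n a := by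
    refine b.induction n (fun k i a' _ => ?_) (by simp) fun x y hx hy => ?_
    · rw [N.smul_mul, constrL_basis_smul, constrL_basis_smul, W.smul_mul]
    · rw [N.add_smul, map_add, map_add, hx, hy, W.add_smul]
  map_mem {i n} hn := by
    refine sum_mem fun k _ => ?_
    have := W.smul_mem (ht k) (b.coord_mem hn k)
    rwa [show b.deg k + m + (i - b.deg k) = i + m by ring] at this

theorem constr_basis {W : DGModule R A} (m : ℤ) (t : κ → W.carrier)
    (ht : ∀ k, t k ∈ W.grading (b.deg k + m)) (k : κ) : (b.constr m t ht).toFun (e k) = t k := by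
  have h := b.constrL_basis_smul t k 1
  rwa [N.smul_one, W.smul_one] at h

include b in
theorem hom_ext {W : DGModule R A} {f g : N.carrier →ₗ[R] W.carrier}
    (hf : ∀ n a, f (N.smul n a) = W.smul (f n) a) (hg : ∀ n a, g (N.smul n a) = W.smul (g n) a)
    (h : ∀ k, f (e k) = g (e k)) : f = g := by
  ext n
  refine b.induction n (fun k i a _ => ?_) (by simp) fun x y hx hy => ?_
  · rw [hf, hg, h]
  · rw [map_add, map_add, hx, hy]

end SemifreeBasisOn
end

noncomputable section

variable {R : Type} [CommRing R] {A B E : DGAlgebra R} {φ : DGAlgHom A B}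

namespace EnvelopingAlg

open Induced

variable (he : EnvelopingAlg φ E) {N : DGModule R B} {κ : Type} {e : κ → N.carrier}
  (b : SemifreeBasisOn N e)

/-- The coordinates of `N|_A ⊗_A B = N ⊗_B E` with respect to a semifree basis of `N`. -/
def coordE : (N.induced φ).carrier →ₗ[R] (κ →₀ E.carrier) :=
  Induced.lift φ (LinearMap.mk₂ R
    (fun n y => Finsupp.mapRange.linearMap
      ((LinearMap.mulRight R (he.r.toFun y)).comp he.l.toLinear) (b.repr n))
    (fun n n' y => by rw [map_add, map_add])
    (fun r n y => by rw [map_smul, map_smul])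
    (fun n y y' => by ext; simp [he.r.map_add, mul_add])
    (fun r n y => by ext; simp [he.r.map_rsmul]))
    fun n a y => by
      ext
      simp [b.repr_smul, he.l.map_mul, he.r.map_mul, he.compat, mul_assoc]

theorem coordE_nt (n : N.carrier) (y : B.carrier) (k : κ) :
    he.coordE b (nt φ N n y) k = he.l.toFun (b.coord k n) * he.r.toFun y := by
  rw [coordE, lift_nt]
  rfl

theorem coordE_pair (n : N.carrier) (z : E.carrier) (k : κ) :
    he.coordE b (he.pair N n z) k = he.l.toFun (b.coord k n) * z := by
  refine he.induction z (fun i j x y _ _ => ?_) (by simp) fun x y hx hy => ?_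
  · rw [pair_mul, coordE_nt, b.coord_smul, he.l.map_mul, mul_assoc]
  · rw [map_add, map_add, Finsupp.add_apply, hx, hy, mul_add]

theorem coordE_pair_basis (k : κ) (z : E.carrier) :
    he.coordE b (he.pair N (e k) z) = Finsupp.single k z := by
  ext j
  rw [coordE_pair]
  rcases eq_or_ne j k with rfl | h
  · rw [b.coord_basis_self, he.l.map_one, one_mul, Finsupp.single_eq_same]
  · rw [b.coord_basis_of_ne h, he.l.map_zero, zero_mul, Finsupp.single_eq_of_ne h]

theorem sum_coordE (t : (N.induced φ).carrier) :
    ((he.coordE b t).sum fun k z => he.pair N (e k) z) = t := by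
  change (Finsupp.lsum R fun k => he.pair N (e k)) (he.coordE b t) = t
  refine Induced.induction t (fun i j n y _ _ => ?_) (by simp) fun x y hx hy => ?_
  · refine b.induction n (fun k i a _ => ?_) (by simp) fun u v hu hv => ?_
    · rw [← he.pair_mul, coordE_pair_basis, Finsupp.lsum_single]
    · rw [LinearMap.map_add₂, map_add, map_add, hu, hv]
  · rw [map_add, map_add, hx, hy]

theorem coordE_smul (t : (N.induced φ).carrier) (y : B.carrier) (k : κ) :
    he.coordE b ((N.induced φ).smul t y) k = he.coordE b t k * he.r.toFun y := by
  refine Induced.induction t (fun i j n y' _ _ => ?_) (by simp) fun u v hu hv => ?_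
  · rw [smul_nt, coordE_nt, coordE_nt, he.r.map_mul, mul_assoc]
  · rw [DGModule.add_smul, map_add, map_add, Finsupp.add_apply, hu, hv, Finsupp.add_apply, add_mul]

theorem coordE_mem {i : ℤ} {t : (N.induced φ).carrier} (ht : t ∈ (N.induced φ).grading i) (k : κ) :
    he.coordE b t k ∈ E.grading (i - b.deg k) := by
  refine map_mem_of_nt φ ((Finsupp.lapply k).comp (he.coordE b)) (E.grading (i - b.deg k))
    (fun p q n y hpq hn hy => ?_) ht
  have h := E.mul_mem (he.l.map_mem (b.coord_mem hn k)) (he.r.map_mem hy)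
  rw [LinearMap.comp_apply, Finsupp.lapply_apply, coordE_nt]
  rwa [show p - b.deg k + q = i - b.deg k by rw [← hpq]; ring] at h

theorem coord_mulMap {πB : DGAlgHom E B} (hl : ∀ b, πB.toFun (he.l.toFun b) = b)
    (hr : ∀ b, πB.toFun (he.r.toFun b) = b) (t : (N.induced φ).carrier) (k : κ) :
    b.coord k ((mulMap φ N).toFun t) = πB.toFun (he.coordE b t k) := by
  change b.coord k (mulMapL φ N t) = πB.toLinear (he.coordE b t k)
  refine Induced.induction t (fun i j n y' _ _ => ?_)
    (by simp only [map_zero, Finsupp.zero_apply]) fun u v hu hv => ?_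
  · rw [mulMapL_nt, b.coord_smul, coordE_nt, DGAlgHom.toLinear_apply, πB.map_mul, hl, hr]
  · rw [map_add, map_add, hu, hv, map_add, Finsupp.add_apply, map_add]

end EnvelopingAlg

theorem LinearMap.ext_of_le_map_eqLocus {M W : Type} [AddCommGroup M] [Module R M]
    [AddCommGroup W] [Module R W] {S : Submodule R M} {f g : S →ₗ[R] W}
    (h : S ≤ (LinearMap.eqLocus f g).map S.subtype) : f = g := by
  ext x
  obtain ⟨y, hy, hyx⟩ := h x.2
  rw [← Subtype.ext hyx]
  exact hy

namespace QuasiSmoothData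

open Induced

variable {he : EnvelopingAlg φ E} {πB : DGAlgHom E B} (sd : QuasiSmoothData φ E he πB)

/-- The filtration of the diagonal ideal, as submodules. -/
def J (ℓ : ℕ) : Submodule R E.carrier where
  carrier := sd.filt ℓ
  add_mem' := sd.filt_add ℓ _ _
  zero_mem' := sd.filt_zero ℓ
  smul_mem' r x := sd.filt_rsmul ℓ r x

variable {sd}

theorem J_le {ℓ : ℕ} {S : Submodule R E.carrier}
    (h : ∀ i x, x ∈ sd.J ℓ → x ∈ E.grading i → x ∈ S) : sd.J ℓ ≤ S := by
  intro x hx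
  have hle : Submodule.span R (sd.filt ℓ ∩ ⋃ i : ℤ, (E.grading i : Set E.carrier)) ≤ S := by
    rw [Submodule.span_le]
    rintro y ⟨hy, hy'⟩
    obtain ⟨i, hi⟩ := Set.mem_iUnion.mp hy'
    exact h i y hy hi
  exact hle (sd.filt_graded ℓ x hx)

theorem J_hom_ext {ℓ : ℕ} {W : Type} [AddCommGroup W] [Module R W] {f g : sd.J ℓ →ₗ[R] W}
    (h : ∀ i x (hx : x ∈ sd.J ℓ), x ∈ E.grading i → f ⟨x, hx⟩ = g ⟨x, hx⟩) : f = g :=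
  LinearMap.ext_of_le_map_eqLocus (J_le fun i x hx hi => ⟨⟨x, hx⟩, h i x hx hi, rfl⟩)

theorem proj_mem_J {ℓ : ℕ} {x : E.carrier} (hx : x ∈ sd.J ℓ) (i : ℤ) :
    E.isGrading.proj i x ∈ sd.J ℓ := by
  have h : sd.J ℓ ≤ (sd.J ℓ).comap (E.isGrading.proj i) := by
    refine J_le fun j y hy hj => ?_
    rw [Submodule.mem_comap]
    rcases eq_or_ne j i with rfl | hne
    · rwa [E.isGrading.proj_of_mem hj]
    · rw [E.isGrading.proj_of_mem_ne hne hj]; exact zero_mem _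
  exact h hx

theorem mul_mem_J_right {ℓ : ℕ} {x : E.carrier} (hx : x ∈ sd.J ℓ) (z : E.carrier) :
    x * z ∈ sd.J ℓ := sd.filt_act ℓ z x hx

theorem mul_mem_J {ℓ : ℕ} {x : E.carrier} (hx : x ∈ sd.J ℓ) (z : E.carrier) :
    z * x ∈ sd.J ℓ := by
  refine E.isGrading.induction z (fun i z hz => ?_) (by simp) fun u v hu hv => ?_
  · have h : sd.J ℓ ≤ (sd.J ℓ).comap (LinearMap.mulLeft R z) := by
      refine J_le fun j y hy hj => ?_
      rw [Submodule.mem_comap, LinearMap.mulLeft_apply, E.gcomm _ _ hz hj]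
      exact zsmul_mem (mul_mem_J_right hy z) _
    exact h hx
  · rw [add_mul]; exact add_mem hu hv

theorem d_mem_J {ℓ : ℕ} {x : E.carrier} (hx : x ∈ sd.J ℓ) : E.d x ∈ sd.J ℓ := sd.filt_d ℓ x hx

variable (sd) {N : DGModule R B} {κ : Type} {e : κ → N.carrier} (b : SemifreeBasisOn N e)

/-- The filtration of `N|_A ⊗_A B = N ⊗_B E` induced by the filtration of the diagonal ideal. -/
def Fil (ℓ : ℕ) : Submodule R (N.induced φ).carrier :=
  ⨅ k, (sd.J ℓ).comap ((Finsupp.lapply k).comp (he.coordE b))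

variable {sd b}

theorem mem_Fil {ℓ : ℕ} {t : (N.induced φ).carrier} :
    t ∈ sd.Fil b ℓ ↔ ∀ k, he.coordE b t k ∈ sd.J ℓ := by
  simp [Fil, Submodule.mem_iInf]

theorem pair_mem_Fil {ℓ : ℕ} {x : E.carrier} (hx : x ∈ sd.J ℓ) (n : N.carrier) :
    he.pair N n x ∈ sd.Fil b ℓ := by
  rw [mem_Fil]
  intro k
  rw [he.coordE_pair]
  exact mul_mem_J hx _

theorem Fil_le {ℓ : ℕ} {S : Submodule R (N.induced φ).carrier}
    (h : ∀ k x, x ∈ sd.J ℓ → he.pair N (e k) x ∈ S) : sd.Fil b ℓ ≤ S := by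
  intro t ht
  rw [← he.sum_coordE b t]
  exact sum_mem fun k _ => h k _ (mem_Fil.mp ht k)

theorem Fil_hom_ext {ℓ : ℕ} {W : Type} [AddCommGroup W] [Module R W] {f g : sd.Fil b ℓ →ₗ[R] W}
    (h : ∀ k x (hx : x ∈ sd.J ℓ), f ⟨he.pair N (e k) x, pair_mem_Fil hx _⟩ =
      g ⟨he.pair N (e k) x, pair_mem_Fil hx _⟩) : f = g :=
  LinearMap.ext_of_le_map_eqLocus (Fil_le fun k x hx => ⟨⟨_, pair_mem_Fil hx _⟩, h k x hx, rfl⟩)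

theorem d_mem_Fil {ℓ : ℕ} {t : (N.induced φ).carrier} (ht : t ∈ sd.Fil b ℓ) :
    (N.induced φ).d t ∈ sd.Fil b ℓ := by
  have h : sd.Fil b ℓ ≤ (sd.Fil b ℓ).comap (N.induced φ).dL := by
    refine Fil_le fun k x hx => ?_
    rw [Submodule.mem_comap, DGModule.dL_apply, he.d_pair]
    exact add_mem (pair_mem_Fil hx _) (pair_mem_Fil (d_mem_J hx) _)
  exact h ht

theorem smul_mem_Fil {ℓ : ℕ} {t : (N.induced φ).carrier} (ht : t ∈ sd.Fil b ℓ) (y : B.carrier) :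
    (N.induced φ).smul t y ∈ sd.Fil b ℓ := by
  rw [mem_Fil] at ht ⊢
  intro k
  rw [he.coordE_smul]
  exact mul_mem_J_right (ht k) _

theorem mem_Fil_one {t : (N.induced φ).carrier} :
    t ∈ sd.Fil b 1 ↔ (mulMap φ N).toFun t = 0 := by
  have hJ : ∀ x, x ∈ sd.J 1 ↔ πB.toFun x = 0 := fun x => by
    change x ∈ sd.filt 1 ↔ _
    rw [sd.filt_one]; rfl
  rw [mem_Fil]
  constructor
  · intro h
    refine b.eq_zero_of_coord fun k => ?_
    rw [he.coord_mulMap b sd.pil sd.pir, ← hJ]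
    exact h k
  · intro h k
    rw [hJ, ← he.coord_mulMap b sd.pil sd.pir, h, map_zero]

theorem Fil_anti {ℓ m : ℕ} (hℓ : 1 ≤ ℓ) (h : ℓ ≤ m) : sd.Fil b m ≤ sd.Fil b ℓ := by
  induction m, h using Nat.le_induction with
  | base => exact le_rfl
  | succ m hm ih =>
    refine le_trans (fun t ht => ?_) ih
    rw [mem_Fil] at ht ⊢
    exact fun k => sd.filt_desc m (hℓ.trans hm) (ht k)

theorem eq_zero_of_mem_Fil {n₀ : ℤ} (hn₀ : ∀ i < n₀, N.grading i = ⊥) {ℓ : ℕ} (hℓ : 1 ≤ ℓ) {i : ℤ}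
    (hi : i < n₀ + ℓ) {t : (N.induced φ).carrier} (ht : t ∈ sd.Fil b ℓ)
    (hti : t ∈ (N.induced φ).grading i) : t = 0 := by
  rw [← he.sum_coordE b t]
  refine Finset.sum_eq_zero fun k _ => ?_
  beta_reduce
  rcases lt_or_ge (b.deg k) n₀ with hk | hk
  · have h := b.homog k
    rw [hn₀ _ hk, Submodule.mem_bot] at h
    rw [h, map_zero, LinearMap.zero_apply]
  · rw [sd.filt_inf ℓ hℓ (i - b.deg k) (by linarith) _ (mem_Fil.mp ht k) (he.coordE_mem b hti k),
      map_zero]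

end QuasiSmoothData
end

noncomputable section

variable {R : Type} [CommRing R] {A B E : DGAlgebra R} {φ : DGAlgHom A B}

namespace SubquotModSpec

open QuasiSmoothData

variable {he : EnvelopingAlg φ E} {πB : DGAlgHom E B} {sd : QuasiSmoothData φ E he πB} {ℓ : ℕ}
  {Q : DGModule R B} (sq : SubquotModSpec he (sd.filt ℓ) (sd.filt (ℓ + 1)) Q)
  {ι : Type} {q : ι → Q.carrier} (bq : SemifreeBasisOn Q q)

/-- The quotient map as a linear map. -/
def qL : sd.J ℓ →ₗ[R] Q.carrier where
  toFun x := sq.q x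
  map_add' x y := sq.q_add x y x.2 y.2
  map_smul' r x := sq.q_rsmul r x x.2

theorem qL_apply (x : sd.J ℓ) : sq.qL x = sq.q x := rfl

theorem qL_proj {x : E.carrier} (hx : x ∈ sd.J ℓ) (i : ℤ) :
    sq.qL ⟨E.isGrading.proj i x, proj_mem_J hx i⟩ = Q.isGrading.proj i (sq.qL ⟨x, hx⟩) := by
  refine LinearMap.congr_fun (f := sq.qL.comp ((E.isGrading.proj i).restrict
    fun x hx => proj_mem_J hx i)) (g := (Q.isGrading.proj i).comp sq.qL)
    (J_hom_ext fun j x hx hj => ?_) ⟨x, hx⟩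
  have hq := sq.q_mem x hx hj
  change sq.q (E.isGrading.proj i x) = Q.isGrading.proj i (sq.q x)
  rcases eq_or_ne j i with rfl | h
  · rw [E.isGrading.proj_of_mem hj, Q.isGrading.proj_of_mem hq]
  · rw [E.isGrading.proj_of_mem_ne h hj, Q.isGrading.proj_of_mem_ne h hq]
    exact map_zero sq.qL

/-- The coordinates of the class of an element of `J^[ℓ]` in `J^[ℓ] / J^[ℓ+1]`. -/
def c (j : ι) : sd.J ℓ →ₗ[R] B.carrier := (bq.coord j).comp sq.qL

theorem c_mul_r (j : ι) {x : E.carrier} (hx : x ∈ sd.J ℓ) (y : B.carrier) :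
    sq.c bq j ⟨x * he.r.toFun y, mul_mem_J_right hx _⟩ = sq.c bq j ⟨x, hx⟩ * y := by
  change bq.coord j (sq.q _) = bq.coord j (sq.q x) * y
  rw [sq.q_act _ _ hx, bq.coord_smul]

theorem c_mem (j : ι) {i : ℤ} {x : E.carrier} (hx : x ∈ sd.J ℓ) (hi : x ∈ E.grading i) :
    sq.c bq j ⟨x, hx⟩ ∈ B.grading (i - bq.deg j) :=
  bq.coord_mem (sq.q_mem x hx hi) j

theorem c_l_mul (hℓ : 1 ≤ ℓ) (j : ι) {x : E.carrier} (hx : x ∈ sd.J ℓ) (y : B.carrier) :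
    sq.c bq j ⟨he.l.toFun y * x, mul_mem_J hx _⟩ = B.sg (bq.deg j) y * sq.c bq j ⟨x, hx⟩ := by
  refine B.isGrading.induction y (fun m y hy => ?_) ?_ fun u v hu hv => ?_
  · refine LinearMap.congr_fun (f := (sq.c bq j).comp ((LinearMap.mulLeft R (he.l.toFun y)).restrict
      fun x hx => mul_mem_J hx _)) (g := (LinearMap.mulLeft R (B.sg (bq.deg j) y)).comp (sq.c bq j))
      (J_hom_ext fun i x hx hi => ?_) ⟨x, hx⟩
    change sq.c bq j ⟨he.l.toFun y * x, mul_mem_J hx _⟩ = B.sg (bq.deg j) y * sq.c bq j ⟨x, hx⟩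
    have hz : (he.l.toFun y - he.r.toFun y) * x ∈ sd.filt (ℓ + 1) := by
      refine (sd.filt_mul ℓ hℓ _ x ?_ hx).1
      change πB.toLinear (he.l.toFun y - he.r.toFun y) = 0
      rw [map_sub, DGAlgHom.toLinear_apply, DGAlgHom.toLinear_apply, sd.pil, sd.pir, sub_self]
    have hz' : (he.l.toFun y - he.r.toFun y) * x ∈ sd.J ℓ := sd.filt_desc ℓ hℓ hz
    have hc : sq.c bq j ⟨_, hz'⟩ = 0 := by
      change bq.coord j (sq.q _) = 0
      rw [(sq.q_ker _ hz').mpr hz, map_zero]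
    have hsum : (⟨he.l.toFun y * x, mul_mem_J hx _⟩ : sd.J ℓ) =
        ⟨_, hz'⟩ + ksign (m * i) • ⟨x * he.r.toFun y, mul_mem_J_right hx _⟩ := by
      refine Subtype.ext ?_
      change he.l.toFun y * x = (he.l.toFun y - he.r.toFun y) * x +
        ksign (m * i) • (x * he.r.toFun y)
      rw [← E.gcomm _ _ (he.r.map_mem hy) hi, sub_mul, sub_add_cancel]
    rw [hsum, map_add, hc, zero_add, map_zsmul, sq.c_mul_r bq j hx,
      B.gcomm _ _ (sq.c_mem bq j hx hi) hy,
      B.sg_of_mem _ hy, smul_smul, ← ksign_add, smul_mul_assoc]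
    congr 1
    refine ksign_congr ⟨m * i - m * bq.deg j, ?_⟩
    ring
  · rw [map_zero, zero_mul]
    refine (congrArg (sq.c bq j) ?_).trans (map_zero _)
    refine Subtype.ext ?_
    change he.l.toFun 0 * x = 0
    rw [he.l.map_zero, zero_mul]
  · rw [map_add, add_mul, ← hu, ← hv, ← map_add]
    congr 1
    refine Subtype.ext ?_
    change he.l.toFun (u + v) * x = he.l.toFun u * x + he.l.toFun v * x
    rw [he.l.map_add, add_mul]

theorem c_d {j : ι} {x : E.carrier} (hx : x ∈ sd.J ℓ)
    (h : ∀ i, bq.lt j i → sq.c bq i ⟨x, hx⟩ = 0) :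
    sq.c bq j ⟨E.d x, d_mem_J hx⟩ = ksign (bq.deg j) • B.d (sq.c bq j ⟨x, hx⟩) := by
  change bq.coord j (sq.q (E.d x)) = _
  rw [sq.q_d x hx]
  exact bq.coord_d h

theorem mem_of_c_eq_zero {x : E.carrier} (hx : x ∈ sd.J ℓ) (h : ∀ j, sq.c bq j ⟨x, hx⟩ = 0) :
    x ∈ sd.J (ℓ + 1) :=
  (sq.q_ker x hx).mp (bq.eq_zero_of_coord h)

theorem exists_homogeneous_lift (j : ι) :
    ∃ x, ∃ hx : x ∈ sd.J ℓ, x ∈ E.grading (bq.deg j) ∧ sq.qL ⟨x, hx⟩ = q j := by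
  obtain ⟨x, hx, hq⟩ := sq.q_surj (q j)
  refine ⟨_, proj_mem_J hx (bq.deg j), E.isGrading.proj_mem _ _, ?_⟩
  rw [sq.qL_proj hx, qL_apply, hq, Q.isGrading.proj_of_mem (bq.homog j)]

/-- A homogeneous representative in `J^[ℓ]` of a basis element of `J^[ℓ] / J^[ℓ+1]`. -/
def rep (j : ι) : E.carrier := (sq.exists_homogeneous_lift bq j).choose

theorem rep_mem_J (j : ι) : sq.rep bq j ∈ sd.J ℓ := (sq.exists_homogeneous_lift bq j).choose_spec.1

theorem rep_mem (j : ι) : sq.rep bq j ∈ E.grading (bq.deg j) :=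
  (sq.exists_homogeneous_lift bq j).choose_spec.2.1

theorem qL_rep (j : ι) : sq.qL ⟨sq.rep bq j, sq.rep_mem_J bq j⟩ = q j :=
  (sq.exists_homogeneous_lift bq j).choose_spec.2.2

theorem c_rep_self (j : ι) : sq.c bq j ⟨sq.rep bq j, sq.rep_mem_J bq j⟩ = 1 := by
  rw [c, LinearMap.comp_apply, qL_rep, bq.coord_basis_self]

theorem c_rep_of_ne {i j : ι} (h : i ≠ j) : sq.c bq i ⟨sq.rep bq j, sq.rep_mem_J bq j⟩ = 0 := by
  rw [c, LinearMap.comp_apply, qL_rep, bq.coord_basis_of_ne h]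

end SubquotModSpec

namespace QuasiSmoothData

variable {he : EnvelopingAlg φ E} {πB : DGAlgHom E B} {sd : QuasiSmoothData φ E he πB} {ℓ : ℕ}
  {N : DGModule R B} {κ : Type} {e : κ → N.carrier} (b : SemifreeBasisOn N e)

/-- The coordinates of an element of `Fil`, as elements of `J^[ℓ]`. -/
def coordJ : sd.Fil b ℓ →ₗ[R] (κ →₀ sd.J ℓ) where
  toFun t := ⟨(he.coordE b t).support, fun k => ⟨he.coordE b t k, mem_Fil.mp t.2 k⟩, fun k => by
    rw [Finsupp.mem_support_iff, Ne, Ne, ← Subtype.coe_inj]; rfl⟩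
  map_add' t u := by
    ext k
    change he.coordE b (t + u) k = he.coordE b t k + he.coordE b u k
    rw [map_add, Finsupp.add_apply]
  map_smul' r t := by
    ext k
    change he.coordE b (r • t) k = r • he.coordE b t k
    rw [map_smul, Finsupp.smul_apply]

/-- The elements `n ⊗ x` of `Fil`, for `x` in `J^[ℓ]`. -/
def pairF (n : N.carrier) : sd.J ℓ →ₗ[R] sd.Fil b ℓ :=
  (he.pair N n).restrict fun _ hx => pair_mem_Fil hx n

theorem coordJ_pairF_basis (k : κ) (x : sd.J ℓ) :
    coordJ b (pairF b (e k) x) = Finsupp.single k x := by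
  classical
  ext j
  change he.coordE b (he.pair N (e k) x) j = _
  rw [he.coordE_pair_basis, Finsupp.single_apply, Finsupp.single_apply]
  split_ifs <;> rfl

theorem sum_coordJ (t : sd.Fil b ℓ) :
    ((coordJ b t).sum fun k x => pairF b (e k) x) = t := by
  refine Subtype.ext ?_
  rw [Finsupp.sum, AddSubmonoidClass.coe_finsetSum]
  exact he.sum_coordE b t

variable {Q : DGModule R B} (sq : SubquotModSpec he (sd.filt ℓ) (sd.filt (ℓ + 1)) Q)
  {ι : Type} {q : ι → Q.carrier} (bq : SemifreeBasisOn Q q)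

/-- The component of an element of `Fil` along the basis element `q j` under the identification
of the associated graded module with `⨁ j, N ⊗ q j`. -/
def p (j : ι) : sd.Fil b ℓ →ₗ[R] N.carrier :=
  (Finsupp.lsum R fun k => (N.smulL (N.sg (bq.deg j) (e k))).comp (sq.c bq j)).comp (coordJ b)

theorem p_apply (j : ι) (t : sd.Fil b ℓ) : p b sq bq j t = (coordJ b t).sum fun k x =>
    N.smul (N.sg (bq.deg j) (e k)) (sq.c bq j x) := rfl

theorem p_pairF (hℓ : 1 ≤ ℓ) (j : ι) (n : N.carrier) (x : sd.J ℓ) :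
    p b sq bq j (pairF b n x) = N.smul (N.sg (bq.deg j) n) (sq.c bq j x) := by
  refine b.induction n (fun k i y hy => ?_) ?_ fun u v hu hv => ?_
  · have h : pairF b (N.smul (e k) y) x =
        pairF b (e k) (⟨he.l.toFun y * x, mul_mem_J x.2 _⟩ : sd.J ℓ) :=
      Subtype.ext (he.pair_smul _ _ _ _)
    rw [h, p, LinearMap.comp_apply, coordJ_pairF_basis, Finsupp.lsum_single, LinearMap.comp_apply,
      sq.c_l_mul bq hℓ j x.2, N.sg_smul, N.smul_mul, N.smulL_apply]
  · have h : pairF b 0 x = 0 := Subtype.ext ((he.pair N).map_zero₂ _)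
    rw [h, map_zero, map_zero, N.zero_smul]
  · have h : pairF b (u + v) x = pairF b u x + pairF b v x :=
      Subtype.ext ((he.pair N).map_add₂ _ _ _)
    rw [h, map_add, map_add, hu, hv, N.add_smul]

theorem p_mem (j : ι) {i : ℤ} {t : sd.Fil b ℓ} (ht : (t : (N.induced φ).carrier) ∈
    (N.induced φ).grading i) : p b sq bq j t ∈ N.grading (i - bq.deg j) := by
  rw [p_apply]
  refine sum_mem fun k _ => ?_
  have h := N.smul_mem (N.sg_mem (bq.deg j) (b.homog k))
    (sq.c_mem bq j (coordJ b t k).2 (he.coordE_mem b ht k))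
  rwa [show b.deg k + (i - b.deg k - bq.deg j) = i - bq.deg j by ring] at h

theorem coord_p (j : ι) (t : sd.Fil b ℓ) (k : κ) :
    b.coord k (p b sq bq j t) = ksign (b.deg k * bq.deg j) • sq.c bq j (coordJ b t k) := by
  refine LinearMap.congr_fun (f := (b.coord k).comp (p b sq bq j)) (g :=
    ksign (b.deg k * bq.deg j) • (sq.c bq j).comp ((Finsupp.lapply k).comp (coordJ b)))
    (Fil_hom_ext fun l x hx => ?_) t
  change b.coord k (p b sq bq j (pairF b (e l) (⟨x, hx⟩ : sd.J ℓ))) = ksign (b.deg k * bq.deg j) •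
    sq.c bq j (coordJ b (pairF b (e l) (⟨x, hx⟩ : sd.J ℓ)) k)
  rw [p, LinearMap.comp_apply, coordJ_pairF_basis, Finsupp.lsum_single, LinearMap.comp_apply,
    N.smulL_apply, N.sg_of_mem _ (b.homog l), N.zsmul_smul, map_zsmul]
  rcases eq_or_ne k l with rfl | h
  · rw [b.coord_basis_smul_self, Finsupp.single_eq_same]
  · rw [b.coord_basis_smul_of_ne h, Finsupp.single_eq_of_ne h, map_zero, smul_zero, smul_zero]

theorem c_coordJ_eq_zero {j : ι} {t : sd.Fil b ℓ} (h : p b sq bq j t = 0) (k : κ) :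
    sq.c bq j (coordJ b t k) = 0 := by
  rw [← ksign_smul_smul (b.deg k * bq.deg j) (sq.c bq j _), ← coord_p, h, map_zero, smul_zero]

theorem mem_Fil_succ_of_p_eq_zero {t : sd.Fil b ℓ} (h : ∀ j, p b sq bq j t = 0) :
    (t : (N.induced φ).carrier) ∈ sd.Fil b (ℓ + 1) :=
  mem_Fil.mpr fun k => sq.mem_of_c_eq_zero bq (coordJ b t k).2
    fun j => c_coordJ_eq_zero b sq bq (h j) k

theorem p_smul (j : ι) (t : sd.Fil b ℓ) (y : B.carrier) :
    p b sq bq j ⟨(N.induced φ).smul t y, smul_mem_Fil t.2 y⟩ = N.smul (p b sq bq j t) y := by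
  refine LinearMap.congr_fun (f := (p b sq bq j).comp
    (((N.induced φ).smulL.flip y).restrict fun t ht => smul_mem_Fil ht y))
    (g := (N.smulL.flip y).comp (p b sq bq j)) (Fil_hom_ext fun k x hx => ?_) t
  have h : (⟨(N.induced φ).smul (he.pair N (e k) x) y, smul_mem_Fil (pair_mem_Fil hx _) y⟩ :
      sd.Fil b ℓ) = pairF b (e k) (⟨x * he.r.toFun y, mul_mem_J_right hx _⟩ : sd.J ℓ) :=
    Subtype.ext (he.pair_mul_r _ _ _ _).symm
  change p b sq bq j ⟨(N.induced φ).smul (he.pair N (e k) x) y, _⟩ =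
    N.smul (p b sq bq j (pairF b (e k) (⟨x, hx⟩ : sd.J ℓ))) y
  simp only [h, p, LinearMap.comp_apply, coordJ_pairF_basis, Finsupp.lsum_single,
    N.smulL_apply, sq.c_mul_r bq j hx, N.smul_mul]

theorem p_d (hℓ : 1 ≤ ℓ) {j : ι} {t : sd.Fil b ℓ} (h : ∀ i, bq.lt j i → p b sq bq i t = 0) :
    p b sq bq j ⟨(N.induced φ).d t, d_mem_Fil t.2⟩ = ksign (bq.deg j) • N.d (p b sq bq j t) := by
  let f : sd.Fil b ℓ →ₗ[R] N.carrier :=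
    (p b sq bq j).comp ((N.induced φ).dL.restrict fun t ht => d_mem_Fil ht)
  let g : sd.Fil b ℓ →ₗ[R] N.carrier := ksign (bq.deg j) • N.dL.comp (p b sq bq j)
  change f t = g t
  conv_lhs => rw [← sum_coordJ b t]
  conv_rhs => rw [← sum_coordJ b t]
  rw [map_finsuppSum, map_finsuppSum]
  refine Finset.sum_congr rfl fun k _ => ?_
  set x := coordJ b t k
  have hd : (⟨(N.induced φ).d (he.pair N (e k) x), d_mem_Fil (pair_mem_Fil x.2 _)⟩ : sd.Fil b ℓ) =
      pairF b (N.d (e k)) x + pairF b (N.sg 1 (e k)) (⟨E.d x, d_mem_J x.2⟩ : sd.J ℓ) :=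
    Subtype.ext (he.d_pair _ _ _)
  change p b sq bq j ⟨(N.induced φ).d (he.pair N (e k) x), _⟩ =
    ksign (bq.deg j) • N.d (p b sq bq j (pairF b (e k) x))
  have hc := sq.c_d bq x.2 fun i hi => c_coordJ_eq_zero b sq bq (h i hi) k
  rw [hd, map_add, p_pairF b sq bq hℓ, p_pairF b sq bq hℓ, p_pairF b sq bq hℓ, hc, N.d_smul,
    N.sg_d, smul_add, N.zsmul_smul, N.smul_zsmul, DGModule.sg, DGModule.sg, N.isGrading.sgn_comm]

end QuasiSmoothData
end

noncomputable section

variable {R : Type} [CommRing R] {A B E : DGAlgebra R} {φ : DGAlgHom A B}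

namespace GradedHom

variable {N T : DGModule R B}

theorem map_zero {k : ℤ} (s : GradedHom N T k) : s.toFun 0 = 0 := s.toLinear.map_zero

theorem map_sg (s : GradedHom N T 0) (j : ℤ) (n : N.carrier) :
    s.toFun (N.sg j n) = T.sg j (s.toFun n) := by
  refine LinearMap.congr_fun (f := s.toLinear.comp (N.sg j)) (g := (T.sg j).comp s.toLinear)
    (N.isGrading.hom_ext fun i n hn => ?_) n
  have h := s.map_mem hn
  rw [add_zero] at h
  rw [LinearMap.comp_apply, LinearMap.comp_apply, N.sg_of_mem j hn, map_zsmul, toLinear_apply,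
    T.sg_of_mem j h]

/-- The failure of a graded homomorphism of degree `0` to be a chain map. -/
def defect (s : GradedHom N T 0) : GradedHom N T (-1) where
  toFun n := T.d (s.toFun n) - s.toFun (N.d n)
  map_add x y := by rw [s.map_add, T.d_add, N.d_add, s.map_add]; abel
  map_rsmul r x := by rw [s.map_rsmul, T.d_rsmul, N.d_rsmul, s.map_rsmul, smul_sub]
  map_smul n a := by
    rw [s.map_smul, T.d_smul, N.d_smul, s.map_add, s.map_smul, s.map_smul, s.map_sg, T.sub_smul]
    abel
  map_mem {i n} hn := by
    have h := T.d_mem (s.map_mem hn)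
    have h' := s.map_mem (N.d_mem hn)
    rw [add_zero] at h h'
    exact sub_mem h h'

theorem defect_apply (s : GradedHom N T 0) (n : N.carrier) :
    s.defect.toFun n = T.d (s.toFun n) - s.toFun (N.d n) := rfl

theorem defect_d (s : GradedHom N T 0) (n : N.carrier) :
    s.defect.toFun (N.d n) = -T.d (s.defect.toFun n) := by
  rw [defect_apply, defect_apply, T.d_sub, N.d_sq, T.d_sq, s.map_zero]
  abel

/-- The sum of a graded homomorphism and an integral multiple of another one. -/
def addZsmul {k : ℤ} (s : GradedHom N T k) (c : ℤ) (h : GradedHom N T k) : GradedHom N T k where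
  toFun n := s.toFun n + c • h.toFun n
  map_add x y := by rw [s.map_add, h.map_add, smul_add]; abel
  map_rsmul r x := by rw [s.map_rsmul, h.map_rsmul, smul_add, smul_comm]
  map_smul n a := by rw [s.map_smul, h.map_smul, T.add_smul, T.zsmul_smul]
  map_mem hn := add_mem (s.map_mem hn) (zsmul_mem (h.map_mem hn) c)

theorem defect_addZsmul (s : GradedHom N T 0) (c : ℤ) (h : GradedHom N T 0) (n : N.carrier) :
    (s.addZsmul c h).defect.toFun n = s.defect.toFun n + c • h.defect.toFun n := by
  change T.d (s.toFun n + c • h.toFun n) - (s.toFun (N.d n) + c • h.toFun (N.d n)) = _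
  rw [T.d_add, T.d_zsmul, defect_apply, defect_apply, smul_sub]
  abel

end GradedHom

namespace QuasiSmoothData

open Induced

variable {he : EnvelopingAlg φ E} {πB : DGAlgHom E B} {sd : QuasiSmoothData φ E he πB} {ℓ : ℕ}
  {N : DGModule R B} {κ : Type} {e : κ → N.carrier} (b : SemifreeBasisOn N e)
  {Q : DGModule R B} (sq : SubquotModSpec he (sd.filt ℓ) (sd.filt (ℓ + 1)) Q)
  {ι : Type} {q : ι → Q.carrier} (bq : SemifreeBasisOn Q q)

/-- The component along `q j` of a graded homomorphism with values in `Fil`. -/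
def comp (j : ι) {k : ℤ} (f : GradedHom N (N.induced φ) k) (hf : ∀ n, f.toFun n ∈ sd.Fil b ℓ) :
    N.carrier →ₗ[R] N.carrier :=
  (p b sq bq j).comp (f.toLinear.codRestrict (sd.Fil b ℓ) hf)

theorem comp_apply (j : ι) {k : ℤ} (f : GradedHom N (N.induced φ) k)
    (hf : ∀ n, f.toFun n ∈ sd.Fil b ℓ) (n : N.carrier) :
    comp b sq bq j f hf n = p b sq bq j ⟨f.toFun n, hf n⟩ := rfl

theorem comp_smul (j : ι) {k : ℤ} (f : GradedHom N (N.induced φ) k)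
    (hf : ∀ n, f.toFun n ∈ sd.Fil b ℓ) (n : N.carrier) (y : B.carrier) :
    comp b sq bq j f hf (N.smul n y) = N.smul (comp b sq bq j f hf n) y := by
  rw [comp_apply, comp_apply, ← p_smul]
  congr 1
  exact Subtype.ext (f.map_smul n y)

theorem comp_mem (j : ι) {k : ℤ} (f : GradedHom N (N.induced φ) k)
    (hf : ∀ n, f.toFun n ∈ sd.Fil b ℓ) {i : ℤ} {n : N.carrier} (hn : n ∈ N.grading i) :
    comp b sq bq j f hf n ∈ N.grading (i + k - bq.deg j) :=
  p_mem b sq bq j (f.map_mem hn)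

theorem defect_mem_Fil {s : GradedHom N (N.induced φ) 0} (hs : ∀ n, s.toFun n ∈ sd.Fil b ℓ)
    (n : N.carrier) : s.defect.toFun n ∈ sd.Fil b ℓ :=
  sub_mem (d_mem_Fil (hs n)) (hs _)

/-- A graded homomorphism with values in `Fil`, with prescribed component along `q j`. -/
theorem exists_comp_eq (hℓ : 1 ≤ ℓ) (j : ι) (h : GradedHom N N (-bq.deg j)) :
    ∃ (f : GradedHom N (N.induced φ) 0) (hf : ∀ n, f.toFun n ∈ sd.Fil b ℓ),
      comp b sq bq j f hf = h.toLinear ∧ ∀ i, i ≠ j → comp b sq bq i f hf = 0 := by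
  let t : κ → (N.induced φ).carrier := fun k =>
    he.pair N (N.sg (bq.deg j) (h.toFun (e k))) (sq.rep bq j)
  have ht : ∀ k, t k ∈ (N.induced φ).grading (b.deg k + 0) := fun k => by
    have := he.pair_mem N (N.sg_mem (bq.deg j) (h.map_mem (b.homog k))) (sq.rep_mem bq j)
    rwa [show b.deg k + -bq.deg j + bq.deg j = b.deg k + 0 by ring] at this
  have hf : ∀ n, (b.constr 0 t ht).toFun n ∈ sd.Fil b ℓ := fun n => by
    refine b.induction n (fun k i y _ => ?_) ?_ fun u v hu hv => ?_
    · rw [GradedHom.map_smul, b.constr_basis]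
      exact smul_mem_Fil (pair_mem_Fil (sq.rep_mem_J bq j) _) _
    · rw [GradedHom.map_zero]; exact zero_mem _
    · rw [GradedHom.map_add]; exact add_mem hu hv
  have hcomp : ∀ i k, comp b sq bq i (b.constr 0 t ht) hf (e k) =
      N.smul (N.sg (bq.deg i) (N.sg (bq.deg j) (h.toFun (e k))))
        (sq.c bq i ⟨sq.rep bq j, sq.rep_mem_J bq j⟩) := fun i k => by
    rw [comp_apply, ← p_pairF b sq bq hℓ]
    congr 1
    exact Subtype.ext (b.constr_basis 0 t ht k)
  refine ⟨b.constr 0 t ht, hf, ?_, fun i hi => ?_⟩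
  · refine b.hom_ext (comp_smul b sq bq j _ hf) h.map_smul fun k => ?_
    rw [hcomp, sq.c_rep_self, N.smul_one]
    exact N.isGrading.sgn_sgn _ _
  · refine b.hom_ext (comp_smul b sq bq i _ hf) (fun n y => (N.zero_smul y).symm) fun k => ?_
    rw [hcomp, sq.c_rep_of_ne bq hi, N.smul_zero]
    rfl

theorem comp_eq_zero_of_deg_neg {j : ι} (hj : bq.deg j < 0) {k : ℤ}
    (f : GradedHom N (N.induced φ) k) (hf : ∀ n, f.toFun n ∈ sd.Fil b ℓ) :
    comp b sq bq j f hf = 0 := by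
  have hx := sq.rep_mem bq j
  rw [E.nonneg _ hj, Submodule.mem_bot] at hx
  have h1 : (1 : B.carrier) = 0 := by
    rw [← sq.c_rep_self bq j, ← LinearMap.map_zero (sq.c bq j)]
    congr 1
    exact Subtype.ext hx
  ext n
  rw [← N.smul_one (comp b sq bq j f hf n), h1, N.smul_zero]
  rfl

variable (hext : ∀ i : ℤ, 1 ≤ i → ExtVanish i N N)
include hext

/-- A graded homomorphism can be modified so that the highest component of its defect vanishes. -/
theorem exists_comp_defect_eq_zero (hℓ : 1 ≤ ℓ) (j : ι) (s : GradedHom N (N.induced φ) 0)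
    (hs : ∀ n, s.defect.toFun n ∈ sd.Fil b ℓ)
    (h0 : ∀ i, bq.lt j i → comp b sq bq i s.defect hs = 0) :
    ∃ (s' : GradedHom N (N.induced φ) 0) (hs' : ∀ n, s'.defect.toFun n ∈ sd.Fil b ℓ),
      (∀ n, s'.toFun n - s.toFun n ∈ sd.Fil b ℓ) ∧
      ∀ i, (bq.lt j i ∨ i = j) → comp b sq bq i s'.defect hs' = 0 := by
  rcases lt_or_ge (bq.deg j) 0 with hj | hj
  · refine ⟨s, hs, fun n => by rw [sub_self]; exact zero_mem _, ?_⟩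
    rintro i (hi | rfl)
    · exact h0 i hi
    · exact comp_eq_zero_of_deg_neg b sq bq hj _ _
  let g : GradedHom N N (-(bq.deg j + 1)) :=
    { toFun := comp b sq bq j s.defect hs
      map_add := map_add _
      map_rsmul := map_smul _
      map_smul := comp_smul b sq bq j _ hs
      map_mem := fun {i x} hx => by
        have h := comp_mem b sq bq j s.defect hs hx
        rwa [show i + -1 - bq.deg j = i + -(bq.deg j + 1) by ring] at h }
  have hg : IsExtCocycle (bq.deg j + 1) g := fun n => by
    have h := p_d b sq bq hℓ (t := ⟨s.defect.toFun n, hs n⟩)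
      fun i hi => LinearMap.congr_fun (h0 i hi) n
    have h' : (⟨s.defect.toFun (N.d n), hs _⟩ : sd.Fil b ℓ) =
        -⟨(N.induced φ).d (s.defect.toFun n), d_mem_Fil (hs n)⟩ := Subtype.ext (s.defect_d n)
    change N.d (p b sq bq j ⟨s.defect.toFun n, hs n⟩) =
      ksign (bq.deg j + 1) • p b sq bq j ⟨s.defect.toFun (N.d n), hs _⟩
    rw [h', _root_.map_neg, h, ksign_add, ksign_one, mul_neg_one, neg_smul, smul_neg, neg_neg,
      ksign_smul_smul]
  obtain ⟨h, hh⟩ := hext _ (by linarith) g hg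
  let h' : GradedHom N N (-bq.deg j) :=
    { h with
      map_mem := fun {i x} hx => by
        have := h.map_mem hx
        rwa [show i + (-(bq.deg j + 1) + 1) = i + -bq.deg j by ring] at this }
  obtain ⟨f, hf, hfj, hfi⟩ := exists_comp_eq b sq bq hℓ j h'
  have hfd : ∀ i n, (∀ i', bq.lt i i' → i' ≠ j) →
      comp b sq bq i f.defect (defect_mem_Fil b hf) n =
      ksign (bq.deg i) • N.d (comp b sq bq i f hf n) - comp b sq bq i f hf (N.d n) := by
    intro i n hi
    rw [comp_apply, comp_apply, comp_apply, ← p_d b sq bq hℓ (t := ⟨f.toFun n, hf n⟩)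
      fun i' hi' => LinearMap.congr_fun (hfi i' (hi i' hi')) n, ← map_sub]
    rfl
  have hs' : ∀ n, (s.addZsmul (-ksign (bq.deg j)) f).defect.toFun n ∈ sd.Fil b ℓ := fun n => by
    rw [GradedHom.defect_addZsmul]
    exact add_mem (hs n) (zsmul_mem (defect_mem_Fil b hf n) _)
  have hcomp : ∀ i n, comp b sq bq i (s.addZsmul (-ksign (bq.deg j)) f).defect hs' n =
      comp b sq bq i s.defect hs n +
        (-ksign (bq.deg j)) • comp b sq bq i f.defect (defect_mem_Fil b hf) n := fun i n => by
    rw [comp_apply, comp_apply, comp_apply, ← map_zsmul, ← map_add]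
    congr 1
    exact Subtype.ext (s.defect_addZsmul _ f n)
  refine ⟨_, hs', fun n => ?_, fun i hi => LinearMap.ext fun n => ?_⟩
  · change s.toFun n + (-ksign (bq.deg j)) • f.toFun n - s.toFun n ∈ _
    rw [add_sub_cancel_left]
    exact zsmul_mem (hf n) _
  · rcases hi with hi | rfl
    · have hij : i ≠ j := by rintro rfl; exact bq.wf.irrefl.irrefl _ hi
      rw [hcomp, h0 i hi, hfd i n, hfi i hij]
      · simp
      · rintro i' hi' rfl
        exact bq.wf.irrefl.irrefl _ (bq.trans _ _ _ hi hi')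
    · rw [hcomp, hfd i n, hfj]
      · change g.toFun n + (-ksign (bq.deg i)) •
          (ksign (bq.deg i) • N.d (h.toFun n) - h.toFun (N.d n)) = 0
        rw [hh n, ksign_add, ksign_one, mul_neg_one, smul_sub, neg_smul, neg_smul,
          ksign_smul_smul]
        abel
      · rintro i' hi' rfl
        exact bq.wf.irrefl.irrefl _ hi'

include sq bq

theorem exists_defect_mem_Fil_succ_aux (hℓ : 1 ≤ ℓ) (S : Finset ι) (s : GradedHom N (N.induced φ) 0)
    (hs : ∀ n, s.defect.toFun n ∈ sd.Fil b ℓ) (hS : ∀ i ∈ S, ∀ k, bq.lt k i → k ∈ S)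
    (h0 : ∀ i ∉ S, comp b sq bq i s.defect hs = 0) :
    ∃ s' : GradedHom N (N.induced φ) 0, (∀ n, s'.toFun n - s.toFun n ∈ sd.Fil b ℓ) ∧
      ∀ n, s'.defect.toFun n ∈ sd.Fil b (ℓ + 1) := by
  classical
  induction hn : S.card generalizing S s with
  | zero =>
    rw [Finset.card_eq_zero] at hn
    subst hn
    refine ⟨s, fun n => by rw [sub_self]; exact zero_mem _, fun n => ?_⟩
    exact mem_Fil_succ_of_p_eq_zero b sq bq (t := ⟨_, hs n⟩)
      fun j => LinearMap.congr_fun (h0 j (Finset.notMem_empty j)) n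
  | succ m ih =>
    have hne : S.Nonempty := Finset.card_pos.mp (by omega)
    obtain ⟨j, hj, hmax⟩ : ∃ j ∈ S, ∀ i ∈ S, ¬ bq.lt j i := by
      have : IsTrans S fun x y => bq.lt y x := ⟨fun x y z h h' => bq.trans _ _ _ h' h⟩
      have : Std.Irrefl fun x y : S => bq.lt y x := ⟨fun x => bq.wf.irrefl.irrefl x.1⟩
      obtain ⟨j, -, hj⟩ := (Finite.wellFounded_of_trans_of_irrefl
        fun x y : S => bq.lt y x).has_min Set.univ ⟨⟨_, hne.choose_spec⟩, trivial⟩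
      exact ⟨j, j.2, fun i hi => hj ⟨i, hi⟩ trivial⟩
    obtain ⟨s₁, hs₁, hd, h₁⟩ := exists_comp_defect_eq_zero b sq bq hext hℓ j s hs
      fun i hi => h0 i fun hiS => hmax i hiS hi
    have hS' : ∀ i ∈ S.erase j, ∀ k, bq.lt k i → k ∈ S.erase j := by
      intro i hi k hk
      rw [Finset.mem_erase] at hi ⊢
      refine ⟨?_, hS i hi.2 k hk⟩
      rintro rfl
      exact hmax i hi.2 hk
    have h₁' : ∀ i ∉ S.erase j, comp b sq bq i s₁.defect hs₁ = 0 := by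
      intro i hi
      refine h₁ i ?_
      by_cases hij : i = j
      · exact Or.inr hij
      rcases bq.trichotomous j i with h | h | h
      · exact Or.inl h
      · exact Or.inr h.symm
      · exact absurd (Finset.mem_erase.mpr ⟨hij, hS j hj i h⟩) hi
    obtain ⟨s₂, hd₂, h₂⟩ := ih (S.erase j) s₁ hs₁ hS' h₁'
      (by rw [Finset.card_erase_of_mem hj, hn, Nat.add_sub_cancel])
    refine ⟨s₂, fun n => ?_, h₂⟩
    rw [← sub_add_sub_cancel _ (s₁.toFun n)]
    exact add_mem (hd₂ n) (hd n)

theorem exists_defect_mem_Fil_succ [Finite ι] (hℓ : 1 ≤ ℓ) (s : GradedHom N (N.induced φ) 0)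
    (hs : ∀ n, s.defect.toFun n ∈ sd.Fil b ℓ) :
    ∃ s' : GradedHom N (N.induced φ) 0, (∀ n, s'.toFun n - s.toFun n ∈ sd.Fil b ℓ) ∧
      ∀ n, s'.defect.toFun n ∈ sd.Fil b (ℓ + 1) := by
  have := Fintype.ofFinite ι
  exact exists_defect_mem_Fil_succ_aux b sq bq hext hℓ Finset.univ s hs
    (fun _ _ k _ => Finset.mem_univ k) fun i hi => absurd (Finset.mem_univ i) hi

end QuasiSmoothData

namespace SmoothData

open Induced QuasiSmoothData

variable {he : EnvelopingAlg φ E} {πB : DGAlgHom E B} (sd : SmoothData φ E he πB)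
  {N : DGModule R B} {κ : Type} {e : κ → N.carrier} (b : SemifreeBasisOn N e)
  (hext : ∀ i : ℤ, 1 ≤ i → ExtVanish i N N)
include hext

theorem exists_approximation (ℓ : ℕ) (s : GradedHom N (N.induced φ) 0)
    (hs : ∀ n, s.defect.toFun n ∈ sd.Fil b (ℓ + 1)) :
    ∃ s' : GradedHom N (N.induced φ) 0, (∀ n, s'.toFun n - s.toFun n ∈ sd.Fil b (ℓ + 1)) ∧
      ∀ n, s'.defect.toFun n ∈ sd.Fil b (ℓ + 1 + 1) := by
  obtain ⟨Q, ⟨sq⟩, ι, q, hι, ⟨bq⟩⟩ := sd.quot_finite (ℓ + 1) (by omega)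
  exact exists_defect_mem_Fil_succ b sq bq hext (by omega) s hs

theorem exists_sequence : ∃ s : ℕ → GradedHom N (N.induced φ) 0,
    (∀ ℓ n, (s ℓ).defect.toFun n ∈ sd.Fil b (ℓ + 1)) ∧
    (∀ ℓ n, (s (ℓ + 1)).toFun n - (s ℓ).toFun n ∈ sd.Fil b (ℓ + 1)) ∧
    ∀ ℓ n, (mulMap φ N).toFun ((s ℓ).toFun n) = n := by
  have ht : ∀ k, nt φ N (e k) 1 ∈ (N.induced φ).grading (b.deg k + 0) :=
    fun k => nt_mem (b.homog k) B.one_mem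
  let s₀ : GradedHom N (N.induced φ) 0 := b.constr 0 _ ht
  have h₀ : ∀ n, (mulMap φ N).toFun (s₀.toFun n) = n := LinearMap.congr_fun
    (f := (mulMapL φ N).comp s₀.toLinear) (g := LinearMap.id) <| by
      refine b.hom_ext (fun n a => ?_) (fun n a => rfl) fun k => ?_
      · exact (congrArg _ (s₀.map_smul n a)).trans ((mulMap φ N).map_smul _ _)
      · change mulMapL φ N ((b.constr 0 _ ht).toFun (e k)) = e k
        rw [b.constr_basis, mulMapL_nt, N.smul_one]
  have hd₀ : ∀ n, s₀.defect.toFun n ∈ sd.Fil b (0 + 1) := fun n => by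
    rw [zero_add, mem_Fil_one]
    change mulMapL φ N (_ - _) = 0
    rw [map_sub, sub_eq_zero]
    exact ((mulMap φ N).comm_d _).trans ((congrArg N.d (h₀ n)).trans (h₀ _).symm)
  choose f hf hf' using sd.exists_approximation b hext
  let s : ∀ ℓ, {s : GradedHom N (N.induced φ) 0 // ∀ n, s.defect.toFun n ∈ sd.Fil b (ℓ + 1)} :=
    Nat.rec ⟨s₀, hd₀⟩ fun ℓ s => ⟨f ℓ s.1 s.2, hf' ℓ s.1 s.2⟩
  have hs : ∀ ℓ n, (s (ℓ + 1)).1.toFun n - (s ℓ).1.toFun n ∈ sd.Fil b (ℓ + 1) :=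
    fun ℓ => hf ℓ (s ℓ).1 (s ℓ).2
  refine ⟨fun ℓ => (s ℓ).1, fun ℓ => (s ℓ).2, hs, fun ℓ => ?_⟩
  induction ℓ with
  | zero => exact h₀
  | succ ℓ ih =>
    intro n
    have h := mem_Fil_one.mp (Fil_anti le_rfl (Nat.le_add_left 1 ℓ) (hs ℓ n))
    change mulMapL φ N (_ - _) = 0 at h
    rw [map_sub, sub_eq_zero] at h
    exact h.trans (ih n)

include sd b

/-- The multiplication map `N|_A ⊗_A B → N` splits. -/
theorem exists_splitting (hbb : BoundedBelow N) :
    ∃ ρ : DGHom N (N.induced φ), ∀ n, (mulMap φ N).toFun (ρ.toFun n) = n := by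
  obtain ⟨s, hd, hs, hπ⟩ := sd.exists_sequence b hext
  obtain ⟨n₀, hn₀⟩ := hbb
  let L : ℤ → ℕ := fun i => (i - n₀).toNat
  have hL : ∀ i m, L i ≤ m → i < n₀ + (m + 1 : ℕ) := fun i m h => by
    simp only [L] at h
    omega
  have hstab : ∀ i m, L i ≤ m → ∀ n ∈ N.grading i, (s m).toFun n = (s (L i)).toFun n := by
    intro i m hm n hn
    induction m, hm using Nat.le_induction with
    | base => rfl
    | succ m hm ih =>
      rw [← ih, ← sub_eq_zero]
      have h := (s (m + 1)).map_mem hn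
      have h' := (s m).map_mem hn
      rw [add_zero] at h h'
      exact eq_zero_of_mem_Fil hn₀ (Nat.le_add_left 1 m) (hL i m hm) (hs m n) (sub_mem h h')
  let ρ : N.carrier →ₗ[R] (N.induced φ).carrier :=
    N.isGrading.lift fun i => (s (L i)).toLinear
  have hρ : ∀ i m, L i ≤ m → ∀ n ∈ N.grading i, ρ n = (s m).toFun n := by
    intro i m hm n hn
    rw [hstab i m hm n hn]
    exact N.isGrading.lift_of_mem _ hn
  refine ⟨⟨ρ, map_add _, map_smul _, fun n a => ?_, fun {i n} hn => ?_, fun n => ?_⟩, fun n => ?_⟩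
  · refine N.isGrading.induction n (fun i n hn => ?_) (by simp) fun u v hu hv => ?_
    · refine B.isGrading.induction a (fun j a ha => ?_) (by simp) fun u v hu hv => ?_
      · rw [hρ i _ (le_max_left _ (L (i + j))) n hn,
          hρ _ _ (le_max_right (L i) _) _ (N.smul_mem hn ha), GradedHom.map_smul]
      · rw [N.smul_add, map_add, hu, hv, DGModule.smul_add]
    · rw [N.add_smul, map_add, hu, hv, map_add, DGModule.add_smul]
  · rw [hρ i _ le_rfl n hn]
    have h := (s (L i)).map_mem hn
    rwa [add_zero] at h
  · refine N.isGrading.induction n (fun i n hn => ?_) (by simp) fun u v hu hv => ?_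
    · have hi : L (i - 1) ≤ L i := by simp only [L]; omega
      rw [hρ i _ le_rfl n hn, hρ _ _ hi _ (N.d_mem hn), eq_comm, ← sub_eq_zero]
      have h := (s (L i)).defect.map_mem hn
      exact eq_zero_of_mem_Fil hn₀ (Nat.le_add_left 1 _) (by have := hL i _ le_rfl; linarith)
        (hd (L i) n) h
    · rw [N.d_add, map_add, hu, hv, map_add, DGModule.d_add]
  · change mulMapL φ N (ρ n) = n
    refine N.isGrading.induction n (fun i n hn => ?_) (by simp) fun u v hu hv => ?_
    · rw [hρ i _ le_rfl n hn]
      exact hπ _ n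
    · rw [map_add, map_add, hu, hv]

end SmoothData
end

noncomputable section

variable {R : Type} [CommRing R] {A B E : DGAlgebra R} {φ : DGAlgHom A B}

/-- The composite of two homomorphisms of DG modules. -/
def DGHom.comp {L M N : DGModule R A} (g : DGHom M N) (f : DGHom L M) : DGHom L N where
  toFun x := g.toFun (f.toFun x)
  map_add x y := by rw [f.map_add, g.map_add]
  map_rsmul r x := by rw [f.map_rsmul, g.map_rsmul]
  map_smul x a := by rw [f.map_smul, g.map_smul]
  map_mem hx := g.map_mem (f.map_mem hx)
  comm_d x := by rw [f.comm_d, g.comm_d]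

theorem naivelyLiftable_of_splitting {N : DGModule R B} (ρ : DGHom N (N.induced φ))
    (hρ : ∀ n, (Induced.mulMap φ N).toFun (ρ.toFun n) = n) : NaivelyLiftable φ N := by
  intro T h πN hπ
  obtain ⟨g, hg, -⟩ := (DGModule.baseChangeSpec φ (DGModule.restrict φ N)).univ T
    ⟨h.unit.toFun, h.unit.map_add, h.unit.map_rsmul, h.unit.map_mem, h.unit.map_smul,
      h.unit.comm_d⟩
  refine ⟨g.comp ρ, fun n => ?_⟩
  have hz := DGHom.ext_baseChange φ (M := DGModule.restrict φ N) (πN.comp g)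
    (Induced.mulMap φ N) (fun m => ?_) (ρ.toFun n)
  · exact hz.trans (hρ n)
  · exact (congrArg πN.toFun (hg m)).trans
      ((hπ m).trans ((Induced.mulMap_nt φ N m 1).trans (N.smul_one m)).symm)

theorem directSummandOfLiftable_of_splitting {N : DGModule R B} (ρ : DGHom N (N.induced φ))
    (hρ : ∀ n, (Induced.mulMap φ N).toFun (ρ.toFun n) = n) : DirectSummandOfLiftable φ N :=
  ⟨N.induced φ, ⟨DGModule.restrict φ N, ⟨DGModule.baseChangeSpec φ _⟩⟩,
    ρ, Induced.mulMap φ N, hρ⟩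

end

/-- Let `φ : A → B` be a DG smooth homomorphism of strongly
commutative DG `R`-algebras. If `N` is a bounded below semifree DG `B`-module with
`Ext^i_B(N, N) = 0` for all `i ≥ 1`, then `N` is naively liftable to `A`, and `N`
is a direct summand of a DG `B`-module that is liftable to `A`. -/
theorem naive_lifting_of_dg_smooth
    {R : Type} [CommRing R] {A B : DGAlgebra R} (φ : DGAlgHom A B)
    (E : DGAlgebra R) (he : EnvelopingAlg φ E) (πB : DGAlgHom E B)
    (sd : SmoothData φ E he πB)
    (N : DGModule R B) (hsf : IsSemifree N) (hbb : BoundedBelow N)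
    (hext : ∀ i : ℤ, 1 ≤ i → ExtVanish i N N) :
    NaivelyLiftable φ N ∧ DirectSummandOfLiftable φ N := by
  obtain ⟨κ, e, ⟨b⟩⟩ := hsf
  obtain ⟨ρ, hρ⟩ := sd.exists_splitting b hext hbb
  exact ⟨naivelyLiftable_of_splitting ρ hρ, directSummandOfLiftable_of_splitting ρ hρ⟩
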